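/- arXiv:1304.1637 — 2 statements merged into one kernel-verified Lean document; each statement's English description precedes it below -/
import Mathlib

section
/- Fix a positive integer t. The injectivity problem for products of upper-triangular 2×2 rational matrices along the bounded pattern z₁x^{m₁}z₂x^{m₂}⋯z_t x^{m_t}z_{t+1} is decidable: the predicate which takes a tuple (M, N₁, …, N_{t+1}) of upper-triangular 2×2 matrices over ℚ with each N_i invertible, and holds if and only if the map ℕ^t → Matrix (Fin 2) (Fin 2) ℚ sending (m₁,…,m_t) to N₁ M^{m₁} N₂ M^{m₂} ⋯ N_t M^{m_t} N_{t+1} is injective, is a computable predicate (with respect to the natural encoding of tuples of rational matrices). -/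
section RatEncoding

open Encodable

/-- The increasing enumeration of a decidable infinite set of naturals is computable. -/
theorem computable_subtype_ofNat (s : Set ℕ) [DecidablePred (· ∈ s)] [Infinite s]
    (hs : PrimrecPred (· ∈ s)) : Computable fun n => (Nat.Subtype.ofNat s n : ℕ) := by
  have hex : ∀ k, ∃ m, k + m ∈ s := fun k => by
    obtain ⟨x, hx, hk⟩ := (Set.infinite_coe_iff.1 ‹Infinite s›).exists_gt k
    exact ⟨x - k, by rwa [Nat.add_sub_cancel' hk.le]⟩
  have hnext : Computable fun k => Nat.find (hex k) := by
    have hp : Computable₂ fun k m : ℕ => decide (k + m ∈ s) :=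
      (hs.comp Primrec.nat_add).decide.to_comp
    refine (Partrec.rfind hp.partrec₂).of_eq_tot fun k => ?_
    rw [Nat.mem_rfind]
    exact ⟨by simp [Nat.find_spec (hex k)], fun hm => by simp [Nat.find_min (hex k) hm]⟩
  have hrec := Computable.nat_rec (f := fun n : ℕ => n) (g := fun _ => 0 + Nat.find (hex 0))
    (h := fun _ (p : ℕ × ℕ) => (p.2 + 1) + Nat.find (hex (p.2 + 1))) Computable.id
    (Computable.const _)
    ((Primrec.nat_add.to_comp.comp (Computable.succ.comp Computable.snd)
      (hnext.comp (Computable.succ.comp Computable.snd))).comp Computable.snd)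
  refine hrec.of_eq fun n => ?_
  induction n with
  | zero =>
    refine le_antisymm ?_ (bot_le (a := (⟨_, Nat.find_spec (hex 0)⟩ : s)))
    have h := (Nat.Subtype.ofNat s 0).2
    have := Nat.find_min' (hex 0) (m := (Nat.Subtype.ofNat s 0 : ℕ)) (by simp)
    simpa using this
  | succ n ih =>
    simp only [Nat.Subtype.ofNat, Nat.Subtype.succ] at ih ⊢
    rw [ih]
    have : ∀ a, a + 1 + Nat.find (hex (a + 1)) = a + Nat.find (hex (a + 1)) + 1 := by
      intro a; ring
    rw [this]
    congr 3
    ext m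
    rw [add_right_comm]

/-- The positive part of the integer with code `u`. -/
def codePos (u : ℕ) : ℕ := if u % 2 = 0 then u / 2 else 0

/-- The negative part of the integer with code `u`. -/
def codeNeg (u : ℕ) : ℕ := if u % 2 = 0 then 0 else u / 2 + 1

theorem codePos_encode (z : ℤ) : codePos (encode z) = z.toNat := by
  cases z with
  | ofNat n =>
    have : encode (Int.ofNat n) = 2 * n := rfl
    rw [this, codePos]; simp
  | negSucc n =>
    have : encode (Int.negSucc n) = 2 * n + 1 := rfl
    rw [this, codePos]; simp

theorem codeNeg_encode (z : ℤ) : codeNeg (encode z) = (-z).toNat := by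
  cases z with
  | ofNat n =>
    have : encode (Int.ofNat n) = 2 * n := rfl
    rw [this, codeNeg]; simp
  | negSucc n =>
    have : encode (Int.negSucc n) = 2 * n + 1 := rfl
    rw [this, codeNeg, if_neg (by omega)]
    simp [Int.neg_negSucc]; omega

theorem primrec_codePos : Primrec codePos :=
  Primrec.ite (Primrec.eq.comp (Primrec.nat_mod.comp Primrec.id (Primrec.const 2))
    (Primrec.const 0)) (Primrec.nat_div.comp Primrec.id (Primrec.const 2)) (Primrec.const 0)

theorem primrec_codeNeg : Primrec codeNeg :=
  Primrec.ite (Primrec.eq.comp (Primrec.nat_mod.comp Primrec.id (Primrec.const 2))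
    (Primrec.const 0)) (Primrec.const 0)
    (Primrec.succ.comp (Primrec.nat_div.comp Primrec.id (Primrec.const 2)))

theorem rat_encode_eq (q : ℚ) :
    @encode ℚ Rat.instEncodable q = Nat.pair (encode q.num) q.den := rfl

theorem mem_range_rat_encode (c : ℕ) : c ∈ Set.range (@encode ℚ Rat.instEncodable) ↔
    c.unpair.2 ≠ 0 ∧
      (codePos c.unpair.1 + codeNeg c.unpair.1).Coprime c.unpair.2 := by
  have key : ∀ z : ℤ, codePos (encode z) + codeNeg (encode z) = z.natAbs := fun z => by
    rw [codePos_encode, codeNeg_encode]; omega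
  constructor
  · rintro ⟨q, rfl⟩
    rw [rat_encode_eq, Nat.unpair_pair]
    simp only [key]
    exact ⟨q.den_nz, q.reduced⟩
  · rintro ⟨h1, h2⟩
    obtain ⟨z, hz⟩ : ∃ z : ℤ, encode z = c.unpair.1 :=
      ⟨Denumerable.ofNat ℤ c.unpair.1, Denumerable.encode_ofNat (α := ℤ) _⟩
    rw [← hz, key] at h2
    refine ⟨⟨z, c.unpair.2, h1, h2⟩, ?_⟩
    rw [rat_encode_eq, hz, Nat.pair_unpair]

theorem primrecRel_coprime : PrimrecRel Nat.Coprime := by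
  have hmod : PrimrecRel fun (x : ℕ) (p : ℕ × ℕ) => p.1 % x = 0 ∧ p.2 % x = 0 → x = 1 := by
    have h1 : PrimrecPred fun r : ℕ × ℕ × ℕ => r.2.1 % r.1 = 0 :=
      Primrec.eq.comp (Primrec.nat_mod.comp (Primrec.fst.comp Primrec.snd) Primrec.fst)
        (Primrec.const 0)
    have h2 : PrimrecPred fun r : ℕ × ℕ × ℕ => r.2.2 % r.1 = 0 :=
      Primrec.eq.comp (Primrec.nat_mod.comp (Primrec.snd.comp Primrec.snd) Primrec.fst)
        (Primrec.const 0)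
    have h3 : PrimrecPred fun r : ℕ × ℕ × ℕ => r.1 = 1 :=
      Primrec.eq.comp Primrec.fst (Primrec.const 1)
    exact ((h1.and h2).not.or h3).of_eq fun r => by tauto
  refine (hmod.forall_mem_list.comp
    (Primrec.list_range.comp (Primrec.succ.comp (Primrec.succ.comp
      (Primrec.nat_add.comp Primrec.fst Primrec.snd)))) Primrec.id).of_eq fun p => ?_
  obtain ⟨a, b⟩ := p
  simp only [id, ← Nat.dvd_iff_mod_eq_zero, List.mem_range]
  constructor
  · intro h
    refine Nat.coprime_of_dvd fun k hk ha hb => hk.one_lt.ne' ?_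
    rcases Nat.eq_zero_or_pos (a + b) with h0 | h0
    · have := h 0 (by omega) ⟨by simp; omega, by simp; omega⟩
      omega
    · refine h k ?_ ⟨ha, hb⟩
      rcases Nat.eq_zero_or_pos a with h' | h'
      · have := Nat.le_of_dvd (by omega) hb
        simp only [Nat.succ_eq_add_one]; omega
      · have := Nat.le_of_dvd h' ha
        simp only [Nat.succ_eq_add_one]; omega
  · rintro h x - ⟨ha, hb⟩
    exact Nat.eq_one_of_dvd_coprimes h ha hb

/-- The triple (positive part of numerator, negative part of numerator, denominator minus one). -/
def ratFrac (q : ℚ) : ℕ × ℕ × ℕ := (q.num.toNat, (-q.num).toNat, q.den - 1)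

theorem exists_encode_ofNat_rat (n : ℕ) :
    ∃ _ : Infinite (Set.range (@encode ℚ Rat.instEncodable)),
      @encode ℚ Rat.instEncodable (Denumerable.ofNat ℚ n) =
        (@Nat.Subtype.ofNat (Set.range (@encode ℚ Rat.instEncodable))
          (@decidableRangeEncode ℚ Rat.instEncodable) _ n).val := by
  let := @decidableRangeEncode ℚ Rat.instEncodable
  let I : Infinite (Set.range (@encode ℚ Rat.instEncodable)) :=
    Infinite.of_injective _ (Equiv.ofInjective _ encode_injective).injective
  let D := Nat.Subtype.denumerable (Set.range (@encode ℚ Rat.instEncodable))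
  refine ⟨I, ?_⟩
  have h1 : Denumerable.ofNat ℚ n = (@equivRangeEncode ℚ Rat.instEncodable).symm
      (Denumerable.ofNat (Set.range (@encode ℚ Rat.instEncodable)) n) :=
    Denumerable.ofEquiv_ofNat (Set.range (@encode ℚ Rat.instEncodable)) (equivRangeEncode ℚ) n
  have h2 : Denumerable.ofNat (Set.range (@encode ℚ Rat.instEncodable)) n =
      Nat.Subtype.ofNat _ n := Denumerable.ofEquiv_ofNat ℕ _ n
  rw [h1, h2]
  exact congrArg Subtype.val
    ((@equivRangeEncode ℚ Rat.instEncodable).apply_symm_apply (Nat.Subtype.ofNat _ n))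

/-- The numerator and denominator of a rational number are computable from its code. -/
theorem computable_ratFrac : Computable ratFrac := by
  let := @decidableRangeEncode ℚ Rat.instEncodable
  obtain ⟨hinf, -⟩ := exists_encode_ofNat_rat 0
  have hmem : PrimrecPred (· ∈ Set.range (@encode ℚ Rat.instEncodable)) := by
    have hu1 := Primrec.fst.comp Primrec.unpair
    have hu2 := Primrec.snd.comp Primrec.unpair
    refine ((Primrec.eq.comp hu2 (Primrec.const 0)).not.and (primrecRel_coprime.comp
      (Primrec.nat_add.comp (primrec_codePos.comp hu1) (primrec_codeNeg.comp hu1))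
      hu2)).of_eq fun c => (mem_range_rat_encode c).symm
  have hcode : Computable fun q : ℚ => @encode ℚ Rat.instEncodable q := by
    refine ((computable_subtype_ofNat _ hmem).comp Computable.encode).of_eq fun q => ?_
    obtain ⟨_, h⟩ := exists_encode_ofNat_rat
      (@encode ℚ (Primcodable.ofDenumerable ℚ).toEncodable q)
    have hq : Denumerable.ofNat ℚ (@encode ℚ (Primcodable.ofDenumerable ℚ).toEncodable q) = q :=
      Denumerable.ofNat_encode q
    rw [hq] at h
    exact h.symm
  have hu1 := Computable.fst.comp (Computable.unpair.comp hcode)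
  have hu2 := Computable.snd.comp (Computable.unpair.comp hcode)
  refine ((primrec_codePos.to_comp.comp hu1).pair ((primrec_codeNeg.to_comp.comp hu1).pair
    (Computable.pred.comp hu2))).of_eq fun q => ?_
  simp only [rat_encode_eq, Nat.unpair_pair, codePos_encode, codeNeg_encode, ratFrac,
    Nat.pred_eq_sub_one]

end RatEncoding

/-- A finite set of naturals containing `0` misses a whole window `[D, D + G)` with small `D`. -/
theorem exists_gap (P : Finset ℕ) (h0 : 0 ∈ P) {n G : ℕ} (hn : P.card ≤ n) (hG : 0 < G) :
    ∃ D, 0 < D ∧ D + G ≤ (n + 1) * G ∧ ∀ e ∈ P, e < D ∨ D + G ≤ e := by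
  obtain ⟨i, hi, hiP⟩ := Finset.exists_mem_notMem_of_card_lt_card
    (s := P.image (· / G)) (t := Finset.range (n + 1))
    (by rw [Finset.card_range]; exact Nat.lt_succ_of_le (Finset.card_image_le.trans hn))
  have hi0 : i ≠ 0 := by
    rintro rfl
    exact hiP (Finset.mem_image.2 ⟨0, h0, Nat.zero_div G⟩)
  refine ⟨i * G, by positivity, ?_, fun e he => ?_⟩
  · rw [← Nat.succ_mul]
    exact Nat.mul_le_mul_right G (Finset.mem_range.1 hi)
  · by_contra! h
    refine hiP (Finset.mem_image.2 ⟨e, he, ?_⟩)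
    refine Nat.div_eq_of_lt_le h.1 ?_
    rw [← Nat.succ_mul] at h
    exact h.2

theorem sum_low_eq_zero_of_abs_le {ι : Type*} (s : Finset ι) (b : ι → ℤ) (e f : ι → ℕ)
    {x y : ℤ} {D E G : ℕ} (hxy : IsCoprime x y) (hle : |y| ≤ |x|) (hx : 2 ≤ |x|)
    (hef : ∀ i ∈ s, e i + f i = E) (hDE : D + G ≤ E) (hG : ∑ i ∈ s, |b i| ≤ G)
    (hgap : ∀ i ∈ s, e i < D ∨ D + G ≤ e i)
    (hsum : ∑ i ∈ s, b i * x ^ e i * y ^ f i = 0) :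
    ∑ i ∈ s, (if e i < D then b i * x ^ e i * y ^ f i else 0) = 0 := by
  set A : ℤ := ∑ i ∈ s, (if e i < D then b i * x ^ e i * y ^ (D - e i) else 0) with hA
  have hlow : ∑ i ∈ s, (if e i < D then b i * x ^ e i * y ^ f i else 0) = y ^ (E - D) * A := by
    rw [hA, Finset.mul_sum]
    refine Finset.sum_congr rfl fun i hi => ?_
    split_ifs with h
    · have := hef i hi
      rw [show f i = (E - D) + (D - e i) by omega, pow_add]
      ring
    · simp
  have hhigh : x ^ (D + G) ∣ ∑ i ∈ s, (if e i < D then 0 else b i * x ^ e i * y ^ f i) := by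
    refine Finset.dvd_sum fun i hi => ?_
    split_ifs with h
    · exact dvd_zero _
    · exact ((pow_dvd_pow x ((hgap i hi).resolve_left h)).mul_left _).mul_right _
  have hsplit : ∑ i ∈ s, (if e i < D then b i * x ^ e i * y ^ f i else 0) +
      ∑ i ∈ s, (if e i < D then 0 else b i * x ^ e i * y ^ f i) = 0 := by
    rw [← Finset.sum_add_distrib]
    refine (Finset.sum_congr rfl fun i _ => ?_).trans hsum
    split_ifs <;> simp
  have hdvd : x ^ (D + G) ∣ A := by
    refine (hxy.pow (m := D + G) (n := E - D)).dvd_of_dvd_mul_left ?_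
    rw [← hlow, eq_neg_of_add_eq_zero_left hsplit]
    exact hhigh.neg_right
  have habs : |A| < |x ^ (D + G)| := by
    have h1 : |A| ≤ ∑ i ∈ s, |b i| * |x| ^ D := by
      refine (Finset.abs_sum_le_sum_abs _ _).trans (Finset.sum_le_sum fun i _ => ?_)
      split_ifs with h
      · rw [abs_mul, abs_mul, abs_pow, abs_pow, mul_assoc]
        refine mul_le_mul_of_nonneg_left ?_ (abs_nonneg _)
        calc |x| ^ e i * |y| ^ (D - e i) ≤ |x| ^ e i * |x| ^ (D - e i) := by gcongr
          _ = |x| ^ D := by rw [← pow_add]; congr 1; omega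
      · simp only [abs_zero]; positivity
    rw [← Finset.sum_mul] at h1
    have h2 : (G : ℤ) < |x| ^ G := by
      calc (G : ℤ) < 2 ^ G := by exact_mod_cast Nat.lt_two_pow_self
        _ ≤ |x| ^ G := by gcongr
    rw [abs_pow, pow_add, mul_comm]
    have : 0 < |x| ^ D := by positivity
    nlinarith
  rw [hlow, Int.eq_zero_of_abs_lt_dvd ((abs_dvd _ _).2 hdvd) habs, mul_zero]

/-- In a vanishing sum of terms `b x ^ e y ^ f` of the same degree with `x`, `y` coprime, the terms
below a sufficiently wide gap in the exponents of `x` sum to zero on their own. -/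
theorem sum_low_eq_zero {ι : Type*} (s : Finset ι) (b : ι → ℤ) (e f : ι → ℕ)
    {x y : ℤ} {D E G : ℕ} (hxy : IsCoprime x y) (hne : |x| ≠ |y|) (hx : x ≠ 0) (hy : y ≠ 0)
    (hef : ∀ i ∈ s, e i + f i = E) (hD : 0 < D) (hDE : D + G ≤ E) (hG : ∑ i ∈ s, |b i| ≤ G)
    (hgap : ∀ i ∈ s, e i < D ∨ D + G ≤ e i)
    (hsum : ∑ i ∈ s, b i * x ^ e i * y ^ f i = 0) :
    ∑ i ∈ s, (if e i < D then b i * x ^ e i * y ^ f i else 0) = 0 := by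
  have hx' := abs_pos.2 hx
  have hy' := abs_pos.2 hy
  rcases lt_or_gt_of_ne hne with h | h
  · have := sum_low_eq_zero_of_abs_le s b f e (D := E - (D + G) + 1) (G := G) (E := E) hxy.symm
      h.le (by omega) (fun i hi => by rw [add_comm, hef i hi]) (by omega) hG
      (fun i hi => by have := hef i hi; have := hgap i hi; omega)
      (by rw [← hsum]; exact Finset.sum_congr rfl fun i _ => by ring)
    have hsplit : ∑ i ∈ s, (if e i < D then b i * x ^ e i * y ^ f i else 0) +
        ∑ i ∈ s, (if f i < E - (D + G) + 1 then b i * y ^ f i * x ^ e i else 0) = 0 := by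
      rw [← Finset.sum_add_distrib]
      refine (Finset.sum_congr rfl fun i hi => ?_).trans hsum
      have h1 := hef i hi
      have h2 := hgap i hi
      by_cases hlt : e i < D
      · rw [if_pos hlt, if_neg (by omega), add_zero]
      · rw [if_neg hlt, if_pos (by omega), zero_add]
        ring
    rwa [this, add_zero] at hsplit
  · exact sum_low_eq_zero_of_abs_le s b e f hxy h.le (by omega) hef hDE hG hgap hsum

/-- An equality between exponential sums along two monotone sequences of exponents can be shrunk,
by removing one unit inside a wide gap at a time, to one with bounded exponents. -/
theorem exists_bounded_partial_sums (c : ℕ → ℤ) {t G : ℕ} {x y : ℤ} (hxy : IsCoprime x y)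
    (hne : |x| ≠ |y|) (hx : x ≠ 0) (hy : y ≠ 0) (hG0 : 0 < G)
    (hG : 2 * ∑ j ∈ Finset.range (t + 1), |c j| ≤ G) (s : ℕ) (K L : ℕ → ℕ) (hK : Monotone K)
    (hL : Monotone L) (hK0 : K 0 = 0) (hL0 : L 0 = 0) (hKt : K t = s) (hLt : L t = s)
    (hKL : ∃ j ≤ t, K j ≠ L j)
    (hsum : ∑ j ∈ Finset.range (t + 1), c j * x ^ K j * y ^ (s - K j) =
      ∑ j ∈ Finset.range (t + 1), c j * x ^ L j * y ^ (s - L j)) :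
    ∃ s' < (2 * t + 3) * G, ∃ K L : ℕ → ℕ, Monotone K ∧ Monotone L ∧ K 0 = 0 ∧ L 0 = 0 ∧
      K t = s' ∧ L t = s' ∧ (∃ j ≤ t, K j ≠ L j) ∧
      ∑ j ∈ Finset.range (t + 1), c j * x ^ K j * y ^ (s' - K j) =
        ∑ j ∈ Finset.range (t + 1), c j * x ^ L j * y ^ (s' - L j) := by
  induction s generalizing K L with
  | zero => exact ⟨0, by positivity, K, L, hK, hL, hK0, hL0, hKt, hLt, hKL, hsum⟩
  | succ s ih =>
    rcases lt_or_ge (s + 1) ((2 * t + 3) * G) with hs | hs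
    · exact ⟨s + 1, hs, K, L, hK, hL, hK0, hL0, hKt, hLt, hKL, hsum⟩
    obtain ⟨D, hD, hDG, hgap⟩ := exists_gap
      ((Finset.range (t + 1)).image K ∪ (Finset.range (t + 1)).image L)
      (Finset.mem_union_left _ (Finset.mem_image.2 ⟨0, by simp, hK0⟩)) (n := 2 * t + 2)
      ((Finset.card_union_le _ _).trans (by
        have h1 := Finset.card_image_le (s := Finset.range (t + 1)) (f := K)
        have h2 := Finset.card_image_le (s := Finset.range (t + 1)) (f := L)
        simp only [Finset.card_range] at h1 h2
        omega)) hG0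
    have hgK : ∀ j ≤ t, K j < D ∨ D + G ≤ K j := fun j hj => hgap _ (Finset.mem_union_left _
      (Finset.mem_image.2 ⟨j, Finset.mem_range.2 (Nat.lt_succ_of_le hj), rfl⟩))
    have hgL : ∀ j ≤ t, L j < D ∨ D + G ≤ L j := fun j hj => hgap _ (Finset.mem_union_right _
      (Finset.mem_image.2 ⟨j, Finset.mem_range.2 (Nat.lt_succ_of_le hj), rfl⟩))
    have hDE : D + G ≤ s + 1 := hDG.trans hs
    have hKs : ∀ j ≤ t, K j ≤ s + 1 := fun j hj => hKt ▸ hK hj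
    have hLs : ∀ j ≤ t, L j ≤ s + 1 := fun j hj => hLt ▸ hL hj
    have hlow := sum_low_eq_zero ((Finset.range (t + 1)).disjSum (Finset.range (t + 1)))
      (Sum.elim c fun j => -c j) (Sum.elim K L)
      (fun i => s + 1 - Sum.elim K L i) (E := s + 1) hxy hne hx hy
      (by
        rintro (j | j) hj
        · have := hKs j (by simpa [Nat.lt_succ_iff] using hj)
          simp only [Sum.elim_inl]; omega
        · have := hLs j (by simpa [Nat.lt_succ_iff] using hj)
          simp only [Sum.elim_inr]; omega) hD hDE
      (by simpa [Finset.sum_disjSum, two_mul] using hG)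
      (by
        rintro (j | j) hj
        · exact hgK j (by simpa [Nat.lt_succ_iff] using hj)
        · exact hgL j (by simpa [Nat.lt_succ_iff] using hj))
      (by
        simp only [Finset.sum_disjSum, Sum.elim_inl, Sum.elim_inr, neg_mul,
          Finset.sum_neg_distrib, hsum]
        ring)
    simp only [Finset.sum_disjSum, Sum.elim_inl, Sum.elim_inr] at hlow
    set φ : ℕ → ℕ := fun k => if k < D then k else k - 1 with hφ
    have hφm : Monotone φ := by
      intro k l hkl
      simp only [hφ]
      split_ifs <;> omega
    have hterm : ∀ j k, (k < D ∨ D + G ≤ k) → k ≤ s + 1 →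
        x * y * (c j * x ^ φ k * y ^ (s - φ k)) = y * (c j * x ^ k * y ^ (s + 1 - k)) +
          (x - y) * (if k < D then c j * x ^ k * y ^ (s + 1 - k) else 0) := by
      intro j k hk hks
      simp only [hφ]
      split_ifs with h
      · rw [show s + 1 - k = (s - k) + 1 by omega]
        ring
      · obtain ⟨l, rfl⟩ : ∃ l, k = l + 1 := ⟨k - 1, by omega⟩
        rw [Nat.add_sub_cancel, Nat.add_sub_add_right]
        ring
    refine ih (φ ∘ K) (φ ∘ L) (hφm.comp hK) (hφm.comp hL) (by simp [hφ, hK0]) (by simp [hφ, hL0])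
      ?_ ?_ ?_ ?_
    · simp only [Function.comp, hKt, hφ]; rw [if_neg (by omega)]; rfl
    · simp only [Function.comp, hLt, hφ]; rw [if_neg (by omega)]; rfl
    · obtain ⟨j, hj, hne⟩ := hKL
      refine ⟨j, hj, ?_⟩
      have h1 := hgK j hj
      have h2 := hgL j hj
      simp only [Function.comp, hφ]
      split_ifs <;> omega
    · refine mul_left_cancel₀ (mul_ne_zero hx hy) ?_
      simp only [Function.comp, Finset.mul_sum]
      rw [Finset.sum_congr rfl fun j hj => hterm j (K j)
          (hgK j (Nat.lt_succ_iff.1 (Finset.mem_range.1 hj)))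
          (hKs j (Nat.lt_succ_iff.1 (Finset.mem_range.1 hj))),
        Finset.sum_congr rfl fun j hj => hterm j (L j)
          (hgL j (Nat.lt_succ_iff.1 (Finset.mem_range.1 hj)))
          (hLs j (Nat.lt_succ_iff.1 (Finset.mem_range.1 hj)))]
      simp only [Finset.sum_add_distrib, ← Finset.mul_sum, hsum]
      have hlow' : ∑ j ∈ Finset.range (t + 1),
            (if K j < D then c j * x ^ K j * y ^ (s + 1 - K j) else 0) =
          ∑ j ∈ Finset.range (t + 1),
            (if L j < D then c j * x ^ L j * y ^ (s + 1 - L j) else 0) := by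
        rw [← sub_eq_zero, sub_eq_add_neg, ← Finset.sum_neg_distrib]
        refine Eq.trans (congrArg _ (Finset.sum_congr rfl fun j _ => ?_)) hlow
        by_cases h : L j < D <;> simp [h]
      rw [hlow']

/-- The product `N₀ x^{m₀} N₁ x^{m₁} ⋯ x^{m_{t-1}} N_t` in a monoid. -/
def boundedProd {α : Type*} [Monoid α] (x : α) (N : ℕ → α) (m : ℕ → ℕ) : ℕ → α
  | 0 => N 0
  | t + 1 => boundedProd x N m t * x ^ m t * N (t + 1)

theorem boundedProd_congr {α : Type*} [Monoid α] (x : α) {N N' : ℕ → α} {m m' : ℕ → ℕ} {t : ℕ}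
    (hN : ∀ i ≤ t, N i = N' i) (hm : ∀ i < t, m i = m' i) :
    boundedProd x N m t = boundedProd x N' m' t := by
  induction t with
  | zero => exact hN 0 le_rfl
  | succ t ih =>
    rw [boundedProd, boundedProd, ih (fun i hi => hN i (by omega)) (fun i hi => hm i (by omega)),
      hN _ le_rfl, hm _ (by omega)]

theorem prod_ofFn_mul_eq_boundedProd {α : Type*} [Monoid α] (x : α) (N : ℕ → α) (m : ℕ → ℕ)
    (t : ℕ) : (List.ofFn fun i : Fin t => N i * x ^ m i).prod * N t = boundedProd x N m t := by
  induction t with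
  | zero => simp [boundedProd]
  | succ t ih =>
    rw [List.ofFn_succ', List.prod_concat, boundedProd, ← ih]
    simp [mul_assoc]

/-- `q` becomes an integer of absolute value at most `H` after multiplication by `D`. -/
def IntBounded (D H : ℕ) (q : ℚ) : Prop := ∃ z : ℤ, D * q = z ∧ |z| ≤ H

namespace IntBounded

variable {D D' H H' : ℕ} {p q : ℚ}

theorem zero : IntBounded D H 0 := ⟨0, by simp, by simp⟩

theorem mul (hp : IntBounded D H p) (hq : IntBounded D' H' q) :
    IntBounded (D * D') (H * H') (p * q) := by
  obtain ⟨y, hy, hy'⟩ := hp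
  obtain ⟨z, hz, hz'⟩ := hq
  refine ⟨y * z, ?_, ?_⟩
  · push_cast
    rw [← hy, ← hz]
    ring
  · rw [abs_mul]
    push_cast
    gcongr

theorem add (hp : IntBounded D H p) (hq : IntBounded D H' q) :
    IntBounded D (H + H') (p + q) := by
  obtain ⟨y, hy, hy'⟩ := hp
  obtain ⟨z, hz, hz'⟩ := hq
  refine ⟨y + z, ?_, ?_⟩
  · push_cast
    rw [← hy, ← hz]
    ring
  · push_cast
    exact (abs_add_le y z).trans (add_le_add hy' hz')

theorem neg (hp : IntBounded D H p) : IntBounded D H (-p) := by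
  obtain ⟨y, hy, hy'⟩ := hp
  exact ⟨-y, by push_cast; rw [← hy]; ring, by rwa [abs_neg]⟩

theorem sub (hp : IntBounded D H p) (hq : IntBounded D H' q) :
    IntBounded D (H + H') (p - q) := by
  rw [sub_eq_add_neg]
  exact hp.add hq.neg

theorem mono (hp : IntBounded D H p) (h : H ≤ H') : IntBounded D H' p := by
  obtain ⟨y, hy, hy'⟩ := hp
  exact ⟨y, hy, hy'.trans (by exact_mod_cast h)⟩

theorem prod {p : ℕ → ℚ} (hp : ∀ i, IntBounded D H (p i)) (n : ℕ) :
    IntBounded (D ^ n) (H ^ n) (∏ i ∈ Finset.range n, p i) := by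
  induction n with
  | zero => exact ⟨1, by simp, by simp⟩
  | succ n ih =>
    rw [Finset.prod_range_succ, pow_succ, pow_succ]
    exact ih.mul (hp n)

end IntBounded

section UpperTriangular

open Finset

variable {M : Matrix (Fin 2) (Fin 2) ℚ} {N : ℕ → Matrix (Fin 2) (Fin 2) ℚ}

theorem pow_apply_one_zero (hM : M 1 0 = 0) (k : ℕ) : (M ^ k) 1 0 = 0 := by
  induction k with
  | zero => simp
  | succ k ih => simp [pow_succ, Matrix.mul_apply, ih, hM]

theorem pow_apply_zero_zero (hM : M 1 0 = 0) (k : ℕ) : (M ^ k) 0 0 = M 0 0 ^ k := by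
  induction k with
  | zero => simp
  | succ k ih => simp [pow_succ, Matrix.mul_apply, ih, hM]

theorem pow_apply_one_one (hM : M 1 0 = 0) (k : ℕ) : (M ^ k) 1 1 = M 1 1 ^ k := by
  induction k with
  | zero => simp
  | succ k ih => simp [pow_succ, Matrix.mul_apply, ih, pow_apply_one_zero hM]

theorem sub_mul_pow_apply_zero_one (hM : M 1 0 = 0) (k : ℕ) :
    (M 1 1 - M 0 0) * (M ^ k) 0 1 = M 0 1 * (M 1 1 ^ k - M 0 0 ^ k) := by
  induction k with
  | zero => simp
  | succ k ih =>
    simp only [pow_succ, Matrix.mul_apply, Fin.sum_univ_two, pow_apply_zero_zero hM, mul_add]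
    linear_combination M 1 1 * ih

theorem mul_pow_apply_zero_one (hM : M 1 0 = 0) (hd : M 1 1 = M 0 0) (k : ℕ) :
    M 0 0 * (M ^ k) 0 1 = k * M 0 1 * M 0 0 ^ k := by
  induction k with
  | zero => simp
  | succ k ih =>
    simp only [pow_succ, Matrix.mul_apply, Fin.sum_univ_two, pow_apply_zero_zero hM, mul_add, hd]
    push_cast
    linear_combination M 0 0 * ih

theorem boundedProd_apply_one_zero (hM : M 1 0 = 0) (hN : ∀ i, N i 1 0 = 0) (m : ℕ → ℕ)
    (t : ℕ) : boundedProd M N m t 1 0 = 0 := by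
  induction t with
  | zero => exact hN 0
  | succ t ih =>
    simp [boundedProd, Matrix.mul_apply, ih, pow_apply_one_zero hM, hN]

theorem boundedProd_apply_zero_zero (hM : M 1 0 = 0) (hN : ∀ i, N i 1 0 = 0) (m : ℕ → ℕ)
    (t : ℕ) : boundedProd M N m t 0 0 =
      (∏ i ∈ range (t + 1), N i 0 0) * M 0 0 ^ ∑ i ∈ range t, m i := by
  induction t with
  | zero => simp [boundedProd]
  | succ t ih =>
    simp only [boundedProd, Matrix.mul_apply, Fin.sum_univ_two, ih, pow_apply_one_zero hM, hN,
      pow_apply_zero_zero hM, sum_range_succ _ t, prod_range_succ _ (t + 1), pow_add]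
    ring

theorem boundedProd_apply_one_one (hM : M 1 0 = 0) (hN : ∀ i, N i 1 0 = 0) (m : ℕ → ℕ)
    (t : ℕ) : boundedProd M N m t 1 1 =
      (∏ i ∈ range (t + 1), N i 1 1) * M 1 1 ^ ∑ i ∈ range t, m i := by
  induction t with
  | zero => simp [boundedProd]
  | succ t ih =>
    simp only [boundedProd, Matrix.mul_apply, Fin.sum_univ_two, ih, pow_apply_one_zero hM,
      boundedProd_apply_one_zero hM hN,
      pow_apply_one_one hM, sum_range_succ _ t, prod_range_succ _ (t + 1), pow_add]
    ring

theorem boundedProd_succ_apply_zero_one (hM : M 1 0 = 0) (hN : ∀ i, N i 1 0 = 0) (m : ℕ → ℕ)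
    (t : ℕ) : boundedProd M N m (t + 1) 0 1 =
      (∏ i ∈ range (t + 1), N i 0 0) * M 0 0 ^ (∑ i ∈ range t, m i) *
          (M 0 0 ^ m t * N (t + 1) 0 1 + (M ^ m t) 0 1 * N (t + 1) 1 1) +
        boundedProd M N m t 0 1 * M 1 1 ^ m t * N (t + 1) 1 1 := by
  simp only [boundedProd, Matrix.mul_apply, Fin.sum_univ_two, boundedProd_apply_zero_zero hM hN,
    pow_apply_one_zero hM, pow_apply_zero_zero hM, pow_apply_one_one hM]
  ring

theorem boundedProd_eq_iff (hM : M 1 0 = 0) (hN : ∀ i, N i 1 0 = 0) (h0 : ∀ i, N i 0 0 ≠ 0)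
    (h1 : ∀ i, N i 1 1 ≠ 0) (m n : ℕ → ℕ) (t : ℕ) :
    boundedProd M N m t = boundedProd M N n t ↔
      M 0 0 ^ (∑ i ∈ range t, m i) = M 0 0 ^ (∑ i ∈ range t, n i) ∧
      M 1 1 ^ (∑ i ∈ range t, m i) = M 1 1 ^ (∑ i ∈ range t, n i) ∧
      boundedProd M N m t 0 1 = boundedProd M N n t 0 1 := by
  rw [← Matrix.ext_iff]
  simp only [Fin.forall_fin_two, boundedProd_apply_one_zero hM hN,
    boundedProd_apply_zero_zero hM hN, boundedProd_apply_one_one hM hN]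
  rw [mul_right_inj' (prod_ne_zero_iff.2 fun i _ => h0 i),
    mul_right_inj' (prod_ne_zero_iff.2 fun i _ => h1 i)]
  tauto

/-- If the diagonal entries of `M` differ, the upper right entry of a bounded product is an
exponential sum in the partial sums of the exponents. -/
theorem exists_sub_mul_boundedProd_apply_eq_sum (hM : M 1 0 = 0) (hN : ∀ i, N i 1 0 = 0)
    {D H : ℕ} (hMb : ∀ u v, IntBounded D H (M u v)) (hNb : ∀ i u v, IntBounded D H (N i u v))
    (t : ℕ) : ∃ c : ℕ → ℚ, (∀ j, IntBounded (D ^ (t + 2)) ((3 * t + 2) * H ^ (t + 2)) (c j)) ∧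
      ∀ m : ℕ → ℕ, (M 1 1 - M 0 0) * boundedProd M N m t 0 1 = ∑ j ∈ range (t + 1),
        c j * M 0 0 ^ (∑ i ∈ range j, m i) *
          M 1 1 ^ ((∑ i ∈ range t, m i) - ∑ i ∈ range j, m i) := by
  induction t with
  | zero =>
    refine ⟨fun _ => (M 1 1 - M 0 0) * N 0 0 1, fun _ => ?_, fun m => by simp [boundedProd]⟩
    simpa [sq, ← two_mul, mul_assoc] using ((hMb 1 1).sub (hMb 0 0)).mul (hNb 0 0 1)
  | succ t ih =>
    obtain ⟨c, hc, hsum⟩ := ih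
    set α := ∏ i ∈ range (t + 1), N i 0 0 with hα
    have hαb : IntBounded (D ^ (t + 1)) (H ^ (t + 1)) α :=
      IntBounded.prod (fun i => hNb i 0 0) _
    refine ⟨fun j => if j < t then c j * N (t + 1) 1 1 else if j = t then
      (c t + α * M 0 1) * N (t + 1) 1 1 else
        α * ((M 1 1 - M 0 0) * N (t + 1) 0 1 - M 0 1 * N (t + 1) 1 1), fun j => ?_, fun m => ?_⟩
    · dsimp only
      rw [show D ^ (t + 1 + 2) = D ^ (t + 2) * D by ring]
      split_ifs
      · refine ((hc j).mul (hNb (t + 1) 1 1)).mono ?_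
        rw [mul_assoc, ← pow_succ]
        exact Nat.mul_le_mul_right _ (by omega)
      · refine (((hc t).add (hαb.mul (hMb 0 1))).mul (hNb (t + 1) 1 1)).mono ?_
        rw [← pow_succ, ← Nat.succ_mul, mul_assoc, ← pow_succ]
        exact Nat.mul_le_mul_right _ (by omega)
      · rw [show D ^ (t + 2) * D = D ^ (t + 1) * (D * D) by ring]
        refine (hαb.mul ((((hMb 1 1).sub (hMb 0 0)).mul (hNb (t + 1) 0 1)).sub
          ((hMb 0 1).mul (hNb (t + 1) 1 1)))).mono ?_
        rw [show H ^ (t + 1) * ((H + H) * H + H * H) = 3 * H ^ (t + 1 + 2) by ring]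
        exact Nat.mul_le_mul_right _ (by omega)
    · have hmono : ∀ j ≤ t, ∑ i ∈ range j, m i ≤ ∑ i ∈ range t, m i := fun j hj =>
        sum_le_sum_of_subset (range_subset_range.2 hj)
      have hlow : ∑ j ∈ range t, (if j < t then c j * N (t + 1) 1 1 else if j = t then
            (c t + α * M 0 1) * N (t + 1) 1 1 else
            α * ((M 1 1 - M 0 0) * N (t + 1) 0 1 - M 0 1 * N (t + 1) 1 1)) *
            M 0 0 ^ (∑ i ∈ range j, m i) *
            M 1 1 ^ ((∑ i ∈ range t, m i) + m t - ∑ i ∈ range j, m i) =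
          (∑ j ∈ range t, c j * M 0 0 ^ (∑ i ∈ range j, m i) *
            M 1 1 ^ ((∑ i ∈ range t, m i) - ∑ i ∈ range j, m i)) *
              M 1 1 ^ m t * N (t + 1) 1 1 := by
        rw [sum_mul, sum_mul]
        refine sum_congr rfl fun j hj => ?_
        rw [if_pos (mem_range.1 hj), tsub_add_eq_add_tsub (hmono j (mem_range.1 hj).le) |>.symm,
          pow_add]
        ring
      have h := hsum m
      rw [sum_range_succ] at h
      rw [boundedProd_succ_apply_zero_one hM hN, sum_range_succ, sum_range_succ, sum_range_succ m,
        hlow]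
      beta_reduce
      rw [if_neg (lt_irrefl t), if_pos rfl, if_neg (by omega), if_neg (by omega),
        Nat.add_sub_cancel_left, Nat.sub_self, pow_zero, pow_add]
      rw [Nat.sub_self, pow_zero] at h
      linear_combination M 1 1 ^ m t * N (t + 1) 1 1 * h +
        α * M 0 0 ^ (∑ i ∈ range t, m i) * N (t + 1) 1 1 * sub_mul_pow_apply_zero_one hM (m t)

/-- If the diagonal entries of `M` agree, the upper right entry of a bounded product is an
affine function of the exponents times a power. -/
theorem exists_mul_boundedProd_apply_eq_sum (hM : M 1 0 = 0) (hN : ∀ i, N i 1 0 = 0)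
    (hd : M 1 1 = M 0 0) {D H : ℕ} (hMb : ∀ u v, IntBounded D H (M u v))
    (hNb : ∀ i u v, IntBounded D H (N i u v)) (t : ℕ) :
    ∃ (e : ℚ) (f : ℕ → ℚ), (∀ j, IntBounded (D ^ (t + 2)) (H ^ (t + 2)) (f j)) ∧
      ∀ m : ℕ → ℕ, M 0 0 * boundedProd M N m t 0 1 =
        M 0 0 ^ (∑ i ∈ range t, m i) * (e + ∑ j ∈ range t, f j * m j) := by
  induction t with
  | zero => exact ⟨M 0 0 * N 0 0 1, 0, fun _ => .zero, fun m => by simp [boundedProd]⟩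
  | succ t ih =>
    obtain ⟨e, f, hf, hsum⟩ := ih
    set α := ∏ i ∈ range (t + 1), N i 0 0 with hα
    have hαb : IntBounded (D ^ (t + 1)) (H ^ (t + 1)) α :=
      IntBounded.prod (fun i => hNb i 0 0) _
    refine ⟨α * N (t + 1) 0 1 * M 0 0 + N (t + 1) 1 1 * e, fun j => if j < t then
      f j * N (t + 1) 1 1 else α * M 0 1 * N (t + 1) 1 1, fun j => ?_, fun m => ?_⟩
    · dsimp only
      rw [pow_succ D, pow_succ H]
      split_ifs
      · exact (hf j).mul (hNb (t + 1) 1 1)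
      · exact (hαb.mul (hMb 0 1)).mul (hNb (t + 1) 1 1)
    · have hlow : ∑ j ∈ range t, (if j < t then
            f j * N (t + 1) 1 1 else α * M 0 1 * N (t + 1) 1 1) * (m j : ℚ) =
          N (t + 1) 1 1 * ∑ j ∈ range t, f j * m j := by
        rw [mul_sum]
        refine sum_congr rfl fun j hj => ?_
        rw [if_pos (mem_range.1 hj)]
        ring
      rw [boundedProd_succ_apply_zero_one hM hN, sum_range_succ m, sum_range_succ, hlow]
      beta_reduce
      rw [if_neg (lt_irrefl t), pow_add, hd]
      linear_combination M 0 0 ^ m t * N (t + 1) 1 1 * hsum m +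
        α * M 0 0 ^ (∑ i ∈ range t, m i) * N (t + 1) 1 1 * mul_pow_apply_zero_one hM hd (m t)

end UpperTriangular

/-- A pair of distinct exponent tuples with entries at most `B` and equal bounded products. -/
def HasCollision {α : Type*} [Monoid α] (x : α) (N : ℕ → α) (t B : ℕ) : Prop :=
  ∃ m n : ℕ → ℕ, (∀ i < t, m i ≤ B ∧ n i ≤ B) ∧ (∃ i < t, m i ≠ n i) ∧
    boundedProd x N m t = boundedProd x N n t

theorem HasCollision.mono {α : Type*} [Monoid α] {x : α} {N : ℕ → α} {t B C : ℕ}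
    (h : HasCollision x N t B) (hBC : B ≤ C) : HasCollision x N t C := by
  obtain ⟨m, n, hb, hne, heq⟩ := h
  exact ⟨m, n, fun i hi => ⟨(hb i hi).1.trans hBC, (hb i hi).2.trans hBC⟩, hne, heq⟩

theorem hasCollision_of_pow_mul_mul_pow_eq {α : Type*} [Monoid α] {x : α} {N : ℕ → α} {t B : ℕ}
    (ht : 2 ≤ t) {u v u' v' : ℕ} (hB : u ≤ B ∧ v ≤ B ∧ u' ≤ B ∧ v' ≤ B) (hne : u ≠ u')
    (h : x ^ u * N 1 * x ^ v = x ^ u' * N 1 * x ^ v') : HasCollision x N t B := by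
  refine ⟨fun i => if i = 0 then u else if i = 1 then v else 0,
    fun i => if i = 0 then u' else if i = 1 then v' else 0, fun i _ => ?_,
    ⟨0, by omega, by simpa using hne⟩, ?_⟩
  · dsimp only
    split_ifs <;> omega
  · induction t, ht using Nat.le_induction with
    | base =>
      simpa [boundedProd, mul_assoc] using congrArg (fun y => N 0 * y * N 2) h
    | succ t ht ih =>
      rw [boundedProd, boundedProd, ih]
      simp only [show t ≠ 0 by omega, show t ≠ 1 by omega, if_false]

theorem eq_zero_or_abs_eq_one_of_pow_eq_pow {a : ℚ} {m n : ℕ} (hmn : m ≠ n)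
    (h : a ^ m = a ^ n) : a = 0 ∨ |a| = 1 := by
  by_contra! hc
  refine hmn (pow_right_injective₀ (abs_pos.2 hc.1) hc.2 ?_)
  simp only [← abs_pow, h]

section Collision

open Finset

variable {M : Matrix (Fin 2) (Fin 2) ℚ} {N : ℕ → Matrix (Fin 2) (Fin 2) ℚ} {t : ℕ} {m n : ℕ → ℕ}

theorem pow_two_eq_pow_four_of_pow_eq_pow (hM : M 1 0 = 0) {k l : ℕ} (hkl : k ≠ l)
    (h : M ^ k = M ^ l) : M ^ 2 = M ^ 4 := by
  have h0 : M 0 0 ^ k = M 0 0 ^ l := by rw [← pow_apply_zero_zero hM, h, pow_apply_zero_zero hM]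
  have h1 : M 1 1 ^ k = M 1 1 ^ l := by rw [← pow_apply_one_one hM, h, pow_apply_one_one hM]
  have ha : M 0 0 = 0 ∨ M 0 0 ^ 2 = 1 := (eq_zero_or_abs_eq_one_of_pow_eq_pow hkl h0).imp_right
    fun h => by rw [← sq_abs, h, one_pow]
  have hd : M 1 1 = 0 ∨ M 1 1 ^ 2 = 1 := (eq_zero_or_abs_eq_one_of_pow_eq_pow hkl h1).imp_right
    fun h => by rw [← sq_abs, h, one_pow]
  have h2 : (M ^ 2) 0 1 = M 0 1 * (M 0 0 + M 1 1) := by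
    simp [sq, Matrix.mul_apply]; ring
  have h4 : (M ^ 4) 0 1 = M 0 1 * (M 0 0 + M 1 1) * (M 0 0 ^ 2 + M 1 1 ^ 2) := by
    rw [show 4 = 2 + 2 from rfl, pow_add, Matrix.mul_apply, Fin.sum_univ_two, h2,
      pow_apply_zero_zero hM, pow_apply_one_one hM]
    ring
  have key : (M ^ 2) 0 1 = (M ^ 4) 0 1 := by
    rw [h2, h4]
    rcases ha with ha | ha <;> rcases hd with hd | hd
    · simp [ha, hd]
    · simp [ha, hd]
    · simp [ha, hd]
    · rcases eq_or_ne (M 1 1) (M 0 0) with he | he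
      · have hk := mul_pow_apply_zero_one hM he k
        rw [h, mul_pow_apply_zero_one hM he l, h0] at hk
        have hpos : M 0 0 ^ l ≠ 0 := pow_ne_zero _ (by rintro h; simp [h] at ha)
        have hkl' : (l : ℚ) - k ≠ 0 := sub_ne_zero.2 (by exact_mod_cast hkl.symm)
        have : ((l : ℚ) - k) * M 0 0 ^ l * M 0 1 = 0 := by linear_combination hk
        simp [(mul_eq_zero.1 this).resolve_left (mul_ne_zero hkl' hpos)]
      · have : (M 1 1 - M 0 0) * (M 0 0 + M 1 1) = 0 := by linear_combination hd - ha
        simp [(mul_eq_zero.1 this).resolve_left (sub_ne_zero.2 he)]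
  have key0 : ∀ a : ℚ, (a = 0 ∨ a ^ 2 = 1) → a ^ 2 = a ^ 4 := by
    rintro a (rfl | ha)
    · simp
    · rw [show 4 = 2 * 2 from rfl, pow_mul, ha, one_pow]
  ext i j
  fin_cases i <;> fin_cases j
  · simpa [pow_apply_zero_zero hM] using key0 _ ha
  · exact key
  · simp [pow_apply_one_zero hM]
  · simpa [pow_apply_one_one hM] using key0 _ hd

theorem hasCollision_one (hM : M 1 0 = 0) (hN : ∀ i, N i 1 0 = 0) (h0 : ∀ i, N i 0 0 ≠ 0)
    (h1 : ∀ i, N i 1 1 ≠ 0) (hne : ∃ i < 1, m i ≠ n i)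
    (heq : boundedProd M N m 1 = boundedProd M N n 1) : HasCollision M N 1 4 := by
  have hdet : ∀ i, IsUnit (N i) := fun i => by
    rw [Matrix.isUnit_iff_isUnit_det, Matrix.det_fin_two, hN, mul_zero, sub_zero]
    exact (mul_ne_zero (h0 i) (h1 i)).isUnit
  obtain ⟨i, hi, hne⟩ := hne
  obtain rfl : i = 0 := by omega
  simp only [boundedProd] at heq
  have h := pow_two_eq_pow_four_of_pow_eq_pow hM hne
    ((hdet 0).mul_left_cancel ((hdet 1).mul_right_cancel heq))
  exact ⟨fun _ => 2, fun _ => 4, by simp, ⟨0, by simp⟩, by simp [boundedProd, h]⟩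

theorem hasCollision_of_mul_eq_zero (hM : M 1 0 = 0) (ht : 2 ≤ t) (h : M 0 0 * M 1 1 = 0) :
    HasCollision M N t 2 := by
  have hsq : M ^ 2 = (M 0 0 + M 1 1) • M := by
    ext i j
    fin_cases i <;> fin_cases j
    all_goals simp only [sq, Matrix.mul_apply, Fin.sum_univ_two, Matrix.smul_apply, smul_eq_mul,
      Fin.zero_eta, Fin.mk_one, hM]
    · linear_combination -h
    · ring
    · ring
    · linear_combination -h
  refine hasCollision_of_pow_mul_mul_pow_eq ht (u := 1) (v := 2) (u' := 2) (v' := 1)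
    (by simp) (by simp) ?_
  simp [hsq]

theorem hasCollision_of_eq_neg (hM : M 1 0 = 0) (ht : 2 ≤ t) (h : M 1 1 = -M 0 0) :
    HasCollision M N t 2 := by
  have hsq : M ^ 2 = (M 0 0 ^ 2) • (1 : Matrix (Fin 2) (Fin 2) ℚ) := by
    ext i j
    fin_cases i <;> fin_cases j
    all_goals simp [sq, Matrix.mul_apply, hM, h] <;> ring
  refine hasCollision_of_pow_mul_mul_pow_eq ht (u := 0) (v := 2) (u' := 2) (v' := 0)
    (by simp) (by simp) ?_
  simp [hsq]

theorem hasCollision_of_sum_eq_zero (hM : M 1 0 = 0) (hN : ∀ i, N i 1 0 = 0)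
    (h0 : ∀ i, N i 0 0 ≠ 0) (h1 : ∀ i, N i 1 1 ≠ 0) (hd : M 1 1 = M 0 0) (ha : M 0 0 ≠ 0) {e : ℚ}
    {f : ℕ → ℚ} (hf : ∀ m : ℕ → ℕ, M 0 0 * boundedProd M N m t 0 1 =
      M 0 0 ^ (∑ i ∈ range t, m i) * (e + ∑ j ∈ range t, f j * m j))
    {B : ℕ} {k : ℕ → ℤ} (hk : ∃ i < t, k i ≠ 0) (hB : ∀ i < t, |k i| ≤ B)
    (hs : ∑ i ∈ range t, k i = 0 ∨ |M 0 0| = 1 ∧ ∀ i < t, Even (k i))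
    (hfk : ∑ i ∈ range t, f i * k i = 0) : HasCollision M N t B := by
  have hsub : ∀ i, (((k i).toNat : ℤ) - ((-k i).toNat : ℤ)) = k i := fun i => by omega
  have hpow : M 0 0 ^ (∑ i ∈ range t, (k i).toNat) = M 0 0 ^ (∑ i ∈ range t, (-k i).toNat) := by
    rcases hs with hs | ⟨habs, hev⟩
    · congr 1
      zify
      rw [← sub_eq_zero, ← sum_sub_distrib, sum_congr rfl fun i _ => hsub i, hs]
    · have h2 : ∀ l : ℕ → ℕ, (∀ i < t, Even (l i)) → M 0 0 ^ (∑ i ∈ range t, l i) = 1 := by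
        intro l hl
        have : Even (∑ i ∈ range t, l i) := even_sum _ fun i hi => hl i (mem_range.1 hi)
        rw [← this.pow_abs, habs, one_pow]
      rw [h2 _ fun i hi => ?_, h2 _ fun i hi => ?_]
      · obtain ⟨l, hl⟩ := hev i hi
        exact ⟨(-l).toNat, by omega⟩
      · obtain ⟨l, hl⟩ := hev i hi
        exact ⟨l.toNat, by omega⟩
  refine ⟨fun i => (k i).toNat, fun i => (-k i).toNat, fun i hi => ?_, ?_, ?_⟩
  · have := abs_le.1 (hB i hi)
    constructor <;> dsimp only <;> omega
  · obtain ⟨i, hi, hki⟩ := hk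
    exact ⟨i, hi, by dsimp only; omega⟩
  · rw [boundedProd_eq_iff hM hN h0 h1, hd]
    refine ⟨hpow, hpow, mul_left_cancel₀ ha ?_⟩
    rw [hf, hf, hpow]
    congr 2
    rw [← sub_eq_zero, ← sum_sub_distrib, ← hfk]
    refine sum_congr rfl fun i _ => ?_
    rw [← mul_sub]
    congr 1
    exact_mod_cast hsub i

theorem hasCollision_of_eq (hM : M 1 0 = 0) (hN : ∀ i, N i 1 0 = 0)
    (h0 : ∀ i, N i 0 0 ≠ 0) (h1 : ∀ i, N i 1 1 ≠ 0) (hd : M 1 1 = M 0 0) (ha : M 0 0 ≠ 0)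
    {D H : ℕ} (hD : 0 < D) (hH : 0 < H) (hMb : ∀ u v, IntBounded D H (M u v))
    (hNb : ∀ i u v, IntBounded D H (N i u v)) (ht : 2 ≤ t) (hne : ∃ i < t, m i ≠ n i)
    (heq : boundedProd M N m t = boundedProd M N n t) :
    HasCollision M N t (2 * H ^ (t + 2)) := by
  obtain ⟨e, f, hfb, hf⟩ := exists_mul_boundedProd_apply_eq_sum hM hN hd hMb hNb t
  choose g hg hgb using hfb
  have hD' : (D : ℚ) ^ (t + 2) ≠ 0 := by positivity
  push_cast at hg hgb
  have hH' : 0 < H ^ (t + 2) := by positivity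
  have hsum : ∀ k : ℕ → ℤ, ∑ i ∈ range t, g i * k i = 0 → ∑ i ∈ range t, f i * k i = 0 := by
    intro k hk
    refine (mul_eq_zero.1 ?_).resolve_left hD'
    rw [mul_sum, ← Int.cast_zero, ← hk]
    push_cast
    exact sum_congr rfl fun i _ => by rw [← mul_assoc, hg]
  have hsub : ∀ (s : ℕ) (_ : s ≤ t) (k : ℕ → ℤ), (∀ i, s ≤ i → k i = 0) →
      ∑ i ∈ range t, k i = ∑ i ∈ range s, k i := fun s hs k hk =>
    (sum_subset (range_subset_range.2 hs) fun i _ hi => hk i (by simpa using hi)).symm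
  have collide := @hasCollision_of_sum_eq_zero M N t hM hN h0 h1 hd ha e f hf (2 * H ^ (t + 2))
  by_cases h01 : g 0 = g 1
  · refine collide (k := fun i => if i = 0 then 1 else if i = 1 then -1 else 0)
      ⟨0, by omega, by simp⟩ (fun i _ => ?_) (Or.inl ?_) (hsum _ ?_)
    · push_cast
      zify at hH'
      split_ifs <;> simp <;> omega
    · rw [hsub 2 ht _ fun i hi => ?_]
      · simp [sum_range_succ]
      · rw [if_neg (by omega), if_neg (by omega)]
    · rw [hsub 2 ht _ fun i hi => ?_]
      · simp [sum_range_succ, h01]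
      · rw [if_neg (by omega), if_neg (by omega), mul_zero]
  have hgb' := fun j => abs_le.1 (hgb j)
  rcases ht.eq_or_lt with rfl | ht
  · by_cases habs : |M 0 0| = 1
    · refine collide (k := fun i => if i = 0 then 2 * g 1 else if i = 1 then -(2 * g 0) else 0)
        ?_ (fun i _ => ?_) (Or.inr ⟨habs, fun i _ => ?_⟩) (hsum _ ?_)
      · by_contra! hc
        have h2 := hc 0 (by omega)
        have h3 := hc 1 (by omega)
        simp at h2 h3
        exact h01 (h3.trans h2.symm)
      · have h2 := hgb' 0
        have h3 := hgb' 1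
        rw [Nat.cast_mul, Nat.cast_pow, abs_le]
        split_ifs <;> constructor <;> omega
      · split_ifs <;> simp
      · simp [sum_range_succ]
        ring
    · exfalso
      obtain ⟨hs, -, hU⟩ := (boundedProd_eq_iff hM hN h0 h1 m n 2).1 heq
      have hse : ∑ i ∈ range 2, m i = ∑ i ∈ range 2, n i := by
        by_contra hc
        rcases eq_zero_or_abs_eq_one_of_pow_eq_pow hc hs with h | h
        exacts [ha h, habs h]
      have hU' := hf m
      rw [hU, hf, hs] at hU'
      have hU'' := mul_left_cancel₀ (pow_ne_zero _ ha) hU'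
      simp only [sum_range_succ, range_zero, sum_empty, zero_add] at hU'' hse
      have hse' : (m 0 : ℚ) + m 1 = n 0 + n 1 := by exact_mod_cast hse
      have hprod : (f 0 - f 1) * ((m 0 : ℚ) - n 0) = 0 := by
        linear_combination -hU'' - f 1 * hse'
      rcases mul_eq_zero.1 hprod with h | h
      · refine h01 ?_
        have : (g 0 : ℚ) = g 1 := by rw [← hg, ← hg, sub_eq_zero.1 h]
        exact_mod_cast this
      · have h' : m 0 = n 0 := by exact_mod_cast sub_eq_zero.1 h
        obtain ⟨i, hi, hmn⟩ := hne
        interval_cases i <;> omega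
  · refine collide (k := fun i => if i = 0 then g 1 - g 2 else if i = 1 then g 2 - g 0 else
      if i = 2 then g 0 - g 1 else 0)
      ⟨2, by omega, by simpa [sub_eq_zero] using h01⟩ (fun i _ => ?_) (Or.inl ?_) (hsum _ ?_)
    · have h2 := hgb' 0
      have h3 := hgb' 1
      have h4 := hgb' 2
      push_cast
      rw [abs_le]
      split_ifs <;> constructor <;> omega
    · rw [hsub 3 ht _ fun i hi => ?_]
      · simp [sum_range_succ]
      · rw [if_neg (by omega), if_neg (by omega), if_neg (by omega)]
    · rw [hsub 3 ht _ fun i hi => ?_]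
      · simp [sum_range_succ]
        ring
      · rw [if_neg (by omega), if_neg (by omega), if_neg (by omega), mul_zero]

theorem exists_eq_mul_isCoprime {a d : ℚ} (ha : a ≠ 0) (hd : d ≠ 0) :
    ∃ (g : ℚ) (x y : ℤ), a = g * x ∧ d = g * y ∧ IsCoprime x y := by
  have hpos : 0 < Int.gcd (a.num * d.den) (d.num * a.den) :=
    Int.gcd_pos_of_ne_zero_left _ (mul_ne_zero (Rat.num_ne_zero.2 ha) (by simp))
  obtain ⟨x, y, hxy, hx, hy⟩ := Int.exists_gcd_one hpos
  have had : (a.den : ℚ) ≠ 0 := by simp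
  have hdd : (d.den : ℚ) ≠ 0 := by simp
  refine ⟨Int.gcd (a.num * d.den) (d.num * a.den) / (a.den * d.den), x, y, ?_, ?_,
    Int.isCoprime_iff_gcd_eq_one.2 hxy⟩
  · have hx' : (a.num * d.den : ℚ) = x * Int.gcd (a.num * d.den) (d.num * a.den) := by
      exact_mod_cast hx
    rw [div_mul_eq_mul_div, mul_comm _ (x : ℚ), ← hx', eq_div_iff (mul_ne_zero had hdd)]
    nth_rewrite 1 [← Rat.num_div_den a]
    field_simp
  · have hy' : (d.num * a.den : ℚ) = y * Int.gcd (a.num * d.den) (d.num * a.den) := by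
      exact_mod_cast hy
    rw [div_mul_eq_mul_div, mul_comm _ (y : ℚ), ← hy', eq_div_iff (mul_ne_zero had hdd)]
    nth_rewrite 1 [← Rat.num_div_den d]
    field_simp

theorem hasCollision_of_abs_ne (hM : M 1 0 = 0) (hN : ∀ i, N i 1 0 = 0)
    (h0 : ∀ i, N i 0 0 ≠ 0) (h1 : ∀ i, N i 1 1 ≠ 0) (ha : M 0 0 ≠ 0) (hd : M 1 1 ≠ 0)
    (had : |M 0 0| ≠ |M 1 1|) {D H : ℕ} (hD : 0 < D) (hMb : ∀ u v, IntBounded D H (M u v))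
    (hNb : ∀ i u v, IntBounded D H (N i u v)) (hne : ∃ i < t, m i ≠ n i)
    (heq : boundedProd M N m t = boundedProd M N n t) :
    HasCollision M N t
      ((2 * t + 3) * (2 * ((t + 1) * ((3 * t + 2) * H ^ (t + 2))) + 1)) := by
  obtain ⟨c, hcb, hc⟩ := exists_sub_mul_boundedProd_apply_eq_sum hM hN hMb hNb t
  choose z hz hzb using hcb
  obtain ⟨g, x, y, hx, hy, hxy⟩ := exists_eq_mul_isCoprime ha hd
  have hg : g ≠ 0 := by rintro rfl; simp at hx; exact ha hx
  have hw : M 1 1 - M 0 0 ≠ 0 := fun h => had (by rw [sub_eq_zero.1 h])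
  have hD' : ((D ^ (t + 2) : ℕ) : ℚ) ≠ 0 := by positivity
  have hmono : ∀ m : ℕ → ℕ, Monotone fun j => ∑ i ∈ range j, m i := fun m i j hij =>
    sum_le_sum_of_subset (range_subset_range.2 hij)
  have hscale : ∀ m : ℕ → ℕ, ((D ^ (t + 2) : ℕ) : ℚ) * (M 1 1 - M 0 0) * boundedProd M N m t 0 1 =
      g ^ (∑ i ∈ range t, m i) * ((∑ j ∈ range (t + 1), z j * x ^ (∑ i ∈ range j, m i) *
        y ^ ((∑ i ∈ range t, m i) - ∑ i ∈ range j, m i) : ℤ) : ℚ) := by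
    intro m
    push_cast only [Int.cast_sum, Int.cast_mul, Int.cast_pow]
    rw [mul_assoc, hc, mul_sum, mul_sum]
    refine sum_congr rfl fun j hj => ?_
    have hj' : ∑ i ∈ range j, m i ≤ ∑ i ∈ range t, m i :=
      hmono m (Nat.lt_succ_iff.1 (mem_range.1 hj))
    rw [← hz, hx, hy, mul_pow, mul_pow, ← Nat.add_sub_cancel' hj', Nat.add_sub_cancel_left, pow_add]
    ring
  obtain ⟨hs0, hs1, hU⟩ := (boundedProd_eq_iff hM hN h0 h1 m n t).1 heq
  have hs : ∑ i ∈ range t, m i = ∑ i ∈ range t, n i := by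
    by_contra hne
    have h2 := (eq_zero_or_abs_eq_one_of_pow_eq_pow hne hs0).resolve_left ha
    have h3 := (eq_zero_or_abs_eq_one_of_pow_eq_pow hne hs1).resolve_left hd
    exact had (h2.trans h3.symm)
  have hsum : ∑ j ∈ range (t + 1), z j * x ^ (∑ i ∈ range j, m i) *
        y ^ ((∑ i ∈ range t, m i) - ∑ i ∈ range j, m i) =
      ∑ j ∈ range (t + 1), z j * x ^ (∑ i ∈ range j, n i) *
        y ^ ((∑ i ∈ range t, m i) - ∑ i ∈ range j, n i) := by
    have h2 := hscale m
    rw [hU, hscale n, ← hs] at h2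
    exact_mod_cast (mul_left_cancel₀ (pow_ne_zero _ hg) h2).symm
  obtain ⟨s, hsB, K, L, hK, hL, hK0, hL0, hKt, hLt, hKL, hsum'⟩ :=
    exists_bounded_partial_sums z hxy
      (fun h => had (by
        rw [hx, hy, abs_mul, abs_mul]
        congr 1
        exact_mod_cast h))
      (fun h => ha (by rw [hx, h]; simp)) (fun h => hd (by rw [hy, h]; simp))
      (G := 2 * ((t + 1) * ((3 * t + 2) * H ^ (t + 2))) + 1) (by omega)
      (by
        have := sum_le_card_nsmul (range (t + 1)) (fun j => |z j|) _ fun j _ => hzb j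
        rw [card_range, nsmul_eq_mul] at this
        push_cast at this ⊢
        linarith)
      (∑ i ∈ range t, m i) _ _ (hmono m) (hmono n) (by simp) (by simp) rfl hs.symm
      (by
        by_contra! hcon
        obtain ⟨i, hi, hne⟩ := hne
        have h2 := hcon i hi.le
        have h3 := hcon (i + 1) hi
        simp only [sum_range_succ] at h2 h3
        omega) hsum
  have htel : ∀ K : ℕ → ℕ, Monotone K → K 0 = 0 → ∀ j,
      ∑ i ∈ range j, (K (i + 1) - K i) = K j := fun K hK hK0 j => by
    rw [sum_range_tsub hK, hK0, Nat.sub_zero]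
  refine ⟨fun i => K (i + 1) - K i, fun i => L (i + 1) - L i, fun i hi => ?_, ?_, ?_⟩
  · have h2 := hK (show i + 1 ≤ t from hi)
    have h3 := hL (show i + 1 ≤ t from hi)
    dsimp only
    omega
  · by_contra! hcon
    obtain ⟨j, hj, hne⟩ := hKL
    refine hne ?_
    rw [← htel K hK hK0, ← htel L hL hL0]
    exact sum_congr rfl fun i hi => hcon i ((mem_range.1 hi).trans_le hj)
  · rw [boundedProd_eq_iff hM hN h0 h1]
    simp only [htel K hK hK0, htel L hL hL0, hKt, hLt, true_and]
    refine mul_left_cancel₀ (mul_ne_zero hD' hw) ?_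
    rw [hscale, hscale]
    simp only [htel K hK hK0, htel L hL hL0, hKt, hLt]
    rw [hsum']

/-- A bound for the exponents in a smallest collision. -/
def collisionBound (t H : ℕ) : ℕ :=
  (2 * t + 3) * (2 * ((t + 1) * ((3 * t + 2) * H ^ (t + 2))) + 1) + 4

/-- If a bounded product is not injective in its exponents, this is witnessed by exponents below
an explicit bound. -/
theorem hasCollision_collisionBound (hM : M 1 0 = 0) (hN : ∀ i, N i 1 0 = 0)
    (h0 : ∀ i, N i 0 0 ≠ 0) (h1 : ∀ i, N i 1 1 ≠ 0) {D H : ℕ} (hD : 0 < D) (hH : 0 < H)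
    (hMb : ∀ u v, IntBounded D H (M u v)) (hNb : ∀ i u v, IntBounded D H (N i u v))
    (ht : 0 < t) (hne : ∃ i < t, m i ≠ n i)
    (heq : boundedProd M N m t = boundedProd M N n t) :
    HasCollision M N t (collisionBound t H) := by
  rcases (show 1 ≤ t from ht).eq_or_lt with rfl | ht
  · exact (hasCollision_one hM hN h0 h1 hne heq).mono (Nat.le_add_left _ _)
  by_cases hz : M 0 0 * M 1 1 = 0
  · exact (hasCollision_of_mul_eq_zero hM ht hz).mono (by rw [collisionBound]; omega)
  obtain ⟨ha, hd⟩ := mul_ne_zero_iff.1 hz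
  by_cases had : |M 0 0| = |M 1 1|
  · rcases abs_eq_abs.1 had with h | h
    · refine (hasCollision_of_eq hM hN h0 h1 h.symm ha hD hH hMb hNb ht hne heq).mono ?_
      rw [collisionBound]
      nlinarith [Nat.zero_le (H ^ (t + 2)), Nat.zero_le (t * H ^ (t + 2)),
        Nat.zero_le (t * t * H ^ (t + 2)), Nat.zero_le (t * t * t * H ^ (t + 2))]
    · exact (hasCollision_of_eq_neg hM ht (by rw [h, neg_neg])).mono
        (by rw [collisionBound]; omega)
  · exact (hasCollision_of_abs_ne hM hN h0 h1 ha hd had hD hMb hNb hne heq).mono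
      (Nat.le_add_right _ _)

end Collision

/-- The rational number `(x - y) / (z + 1)`. -/
def fracVal (f : ℕ × ℕ × ℕ) : ℚ := ((f.1 : ℚ) - f.2.1) / (f.2.2 + 1)

theorem fracVal_ratFrac (q : ℚ) : fracVal (ratFrac q) = q := by
  have h1 : ((q.num.toNat : ℚ)) - ((-q.num).toNat : ℚ) = q.num := by
    have : ((q.num.toNat : ℤ)) - ((-q.num).toNat : ℤ) = q.num := by omega
    exact_mod_cast this
  have h2 : ((q.den - 1 : ℕ) : ℚ) + 1 = q.den := by
    exact_mod_cast Nat.sub_add_cancel q.den_pos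
  rw [fracVal, ratFrac, h1, h2, Rat.num_div_den]

/-- Multiplication of fractions. -/
def fracMul (f g : ℕ × ℕ × ℕ) : ℕ × ℕ × ℕ :=
  (f.1 * g.1 + f.2.1 * g.2.1, f.1 * g.2.1 + f.2.1 * g.1, f.2.2 * g.2.2 + f.2.2 + g.2.2)

/-- Addition of fractions. -/
def fracAdd (f g : ℕ × ℕ × ℕ) : ℕ × ℕ × ℕ :=
  (f.1 * (g.2.2 + 1) + g.1 * (f.2.2 + 1), f.2.1 * (g.2.2 + 1) + g.2.1 * (f.2.2 + 1),
    f.2.2 * g.2.2 + f.2.2 + g.2.2)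

/-- Equality of fractions as rational numbers. -/
def FracEq (f g : ℕ × ℕ × ℕ) : Prop :=
  f.1 * (g.2.2 + 1) + g.2.1 * (f.2.2 + 1) = g.1 * (f.2.2 + 1) + f.2.1 * (g.2.2 + 1)

theorem fracVal_fracMul (f g : ℕ × ℕ × ℕ) : fracVal (fracMul f g) = fracVal f * fracVal g := by
  simp only [fracVal, fracMul]
  have h1 : (f.2.2 : ℚ) + 1 ≠ 0 := by positivity
  have h2 : (g.2.2 : ℚ) + 1 ≠ 0 := by positivity
  rw [div_mul_div_comm]
  push_cast
  congr 1 <;> ring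

theorem fracVal_fracAdd (f g : ℕ × ℕ × ℕ) : fracVal (fracAdd f g) = fracVal f + fracVal g := by
  simp only [fracVal, fracAdd]
  have h1 : (f.2.2 : ℚ) + 1 ≠ 0 := by positivity
  have h2 : (g.2.2 : ℚ) + 1 ≠ 0 := by positivity
  rw [div_add_div _ _ h1 h2]
  push_cast
  congr 1 <;> ring

theorem fracEq_iff (f g : ℕ × ℕ × ℕ) : FracEq f g ↔ fracVal f = fracVal g := by
  have h1 : (f.2.2 : ℚ) + 1 ≠ 0 := by positivity
  have h2 : (g.2.2 : ℚ) + 1 ≠ 0 := by positivity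
  rw [fracVal, fracVal, div_eq_div_iff h1 h2, FracEq, ← @Nat.cast_inj ℚ]
  push_cast
  constructor <;> intro h <;> linear_combination h

theorem intBounded_fracVal {f : ℕ × ℕ × ℕ} {D H : ℕ} (hD : f.2.2 + 1 ∣ D)
    (hH : (f.1 + f.2.1 + 1) * D ≤ H) : IntBounded D H (fracVal f) := by
  obtain ⟨k, rfl⟩ := hD
  refine ⟨(f.1 - f.2.1) * k, ?_, ?_⟩
  · have h1 : (f.2.2 : ℚ) + 1 ≠ 0 := by positivity
    rw [fracVal]
    push_cast
    field_simp
  · have h2 : |(f.1 : ℤ) - f.2.1| ≤ f.1 + f.2.1 + 1 := by rw [abs_le]; omega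
    have h3 : (k : ℤ) ≤ (f.2.2 + 1) * k := by nlinarith [Int.natCast_nonneg k]
    zify at hH
    rw [abs_mul, Nat.abs_cast]
    exact (mul_le_mul h2 h3 (by positivity) (by positivity)).trans hH

/-- Triples of fractions, representing the diagonal entries and the upper right entry of an
upper-triangular matrix in the order `(0, 0)`, `(0, 1)`, `(1, 1)`. -/
abbrev FracTri : Type := (ℕ × ℕ × ℕ) × (ℕ × ℕ × ℕ) × (ℕ × ℕ × ℕ)

namespace FracTri

/-- The upper-triangular matrix represented by a triple of fractions. -/
def val (x : FracTri) : Matrix (Fin 2) (Fin 2) ℚ :=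
  !![fracVal x.1, fracVal x.2.1; 0, fracVal x.2.2]

/-- The representation of an upper-triangular matrix. -/
def ofMatrix (A : Fin 2 → Fin 2 → ℚ) : FracTri :=
  (ratFrac (A 0 0), ratFrac (A 0 1), ratFrac (A 1 1))

theorem val_ofMatrix {A : Fin 2 → Fin 2 → ℚ} (hA : A 1 0 = 0) :
    val (ofMatrix A) = Matrix.of A := by
  ext i j
  fin_cases i <;> fin_cases j <;> simp [val, ofMatrix, fracVal_ratFrac, hA]

/-- Matrix multiplication on representations. -/
def mul (x y : FracTri) : FracTri :=
  (fracMul x.1 y.1, fracAdd (fracMul x.1 y.2.1) (fracMul x.2.1 y.2.2), fracMul x.2.2 y.2.2)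

theorem val_mul (x y : FracTri) : val (mul x y) = val x * val y := by
  simp [val, mul, fracVal_fracMul, fracVal_fracAdd]

/-- Powers on representations. -/
def pow (x : FracTri) (k : ℕ) : FracTri :=
  Nat.rec ((1, 0, 0), (0, 0, 0), (1, 0, 0)) (fun _ y => mul y x) k

theorem val_pow (x : FracTri) (k : ℕ) : val (pow x k) = val x ^ k := by
  induction k with
  | zero => simp [pow, val, fracVal, Matrix.one_fin_two]
  | succ k ih => rw [pow_succ, ← ih, ← val_mul]; rfl

/-- Bounded products on representations, for a list of factors and a list of exponents. -/
def prod (x : FracTri) (L : List FracTri) (m : List ℕ) : ℕ → FracTri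
  | 0 => L.getD 0 default
  | t + 1 => mul (mul (prod x L m t) (pow x (m.getD t 0))) (L.getD (t + 1) default)

theorem val_prod (x : FracTri) (L : List FracTri) (m : List ℕ) (t : ℕ) : val (prod x L m t) =
    boundedProd (val x) (fun i => val (L.getD i default)) (fun i => m.getD i 0) t := by
  induction t with
  | zero => rfl
  | succ t ih => rw [prod, val_mul, val_mul, val_pow, ih, boundedProd]

/-- Equality of the represented matrices. -/
def Equiv (x y : FracTri) : Prop := FracEq x.1 y.1 ∧ FracEq x.2.1 y.2.1 ∧ FracEq x.2.2 y.2.2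

theorem equiv_iff (x y : FracTri) : Equiv x y ↔ val x = val y := by
  simp [Equiv, val, fracEq_iff, and_assoc]

/-- A common denominator of the entries. -/
def den (x : FracTri) : ℕ := (x.1.2.2 + 1) * ((x.2.1.2.2 + 1) * (x.2.2.2.2 + 1))

/-- A bound for the numerators of the entries. -/
def height (x : FracTri) : ℕ :=
  (x.1.1 + x.1.2.1 + 1) * ((x.2.1.1 + x.2.1.2.1 + 1) * (x.2.2.1 + x.2.2.2.1 + 1))

theorem intBounded_val {x : FracTri} {D E H : ℕ} (hD : den x ∣ D) (hE : height x ∣ E)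
    (hE0 : 0 < E) (hH : E * D ≤ H) (u v : Fin 2) : IntBounded D H (val x u v) := by
  have key : ∀ f : ℕ × ℕ × ℕ, f.2.2 + 1 ∣ den x → f.1 + f.2.1 + 1 ∣ height x →
      IntBounded D H (fracVal f) := fun f h1 h2 => intBounded_fracVal (h1.trans hD)
    ((Nat.mul_le_mul_right D (Nat.le_of_dvd hE0 (h2.trans hE))).trans hH)
  fin_cases u <;> fin_cases v
  · exact key _ (dvd_mul_right _ _) (dvd_mul_right _ _)
  · exact key _ ((dvd_mul_right _ _).mul_left _) ((dvd_mul_right _ _).mul_left _)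
  · exact .zero
  · exact key _ ((dvd_mul_left _ _).mul_left _) ((dvd_mul_left _ _).mul_left _)

theorem primrec_triple_projections (α β γ : Type*) [Primcodable α] [Primcodable β]
    [Primcodable γ] :
    (Primrec fun p : (α × β × γ) × (α × β × γ) => p.1.1) ∧
    (Primrec fun p : (α × β × γ) × (α × β × γ) => p.1.2.1) ∧
    (Primrec fun p : (α × β × γ) × (α × β × γ) => p.1.2.2) ∧
    (Primrec fun p : (α × β × γ) × (α × β × γ) => p.2.1) ∧
    (Primrec fun p : (α × β × γ) × (α × β × γ) => p.2.2.1) ∧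
    (Primrec fun p : (α × β × γ) × (α × β × γ) => p.2.2.2) :=
  ⟨Primrec.fst.comp Primrec.fst, Primrec.fst.comp (Primrec.snd.comp Primrec.fst),
    Primrec.snd.comp (Primrec.snd.comp Primrec.fst), Primrec.fst.comp Primrec.snd,
    Primrec.fst.comp (Primrec.snd.comp Primrec.snd),
    Primrec.snd.comp (Primrec.snd.comp Primrec.snd)⟩

theorem primrec_fracMul : Primrec₂ fracMul := by
  obtain ⟨a1, a2, a3, b1, b2, b3⟩ := primrec_triple_projections ℕ ℕ ℕ
  have hadd := @Primrec.nat_add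
  have hmul := @Primrec.nat_mul
  exact (hadd.comp (hmul.comp a1 b1) (hmul.comp a2 b2)).pair
    ((hadd.comp (hmul.comp a1 b2) (hmul.comp a2 b1)).pair
      (hadd.comp (hadd.comp (hmul.comp a3 b3) a3) b3))

theorem primrec_fracAdd : Primrec₂ fracAdd := by
  obtain ⟨a1, a2, a3, b1, b2, b3⟩ := primrec_triple_projections ℕ ℕ ℕ
  have hadd := @Primrec.nat_add
  have hmul := @Primrec.nat_mul
  have a3' := Primrec.succ.comp a3
  have b3' := Primrec.succ.comp b3
  exact (hadd.comp (hmul.comp a1 b3') (hmul.comp b1 a3')).pair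
    ((hadd.comp (hmul.comp a2 b3') (hmul.comp b2 a3')).pair
      (hadd.comp (hadd.comp (hmul.comp a3 b3) a3) b3))

theorem primrecRel_fracEq : PrimrecRel FracEq := by
  obtain ⟨a1, a2, a3, b1, b2, b3⟩ := primrec_triple_projections ℕ ℕ ℕ
  have hadd := @Primrec.nat_add
  have hmul := @Primrec.nat_mul
  have a3' := Primrec.succ.comp a3
  have b3' := Primrec.succ.comp b3
  exact Primrec.eq.comp (hadd.comp (hmul.comp a1 b3') (hmul.comp b2 a3'))
    (hadd.comp (hmul.comp b1 a3') (hmul.comp a2 b3'))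

theorem primrec_mul : Primrec₂ mul := by
  obtain ⟨a1, a2, a3, b1, b2, b3⟩ := primrec_triple_projections (ℕ × ℕ × ℕ) (ℕ × ℕ × ℕ) (ℕ × ℕ × ℕ)
  exact (primrec_fracMul.comp a1 b1).pair ((primrec_fracAdd.comp (primrec_fracMul.comp a1 b2)
    (primrec_fracMul.comp a2 b3)).pair (primrec_fracMul.comp a3 b3))

theorem primrecRel_equiv : PrimrecRel Equiv := by
  obtain ⟨a1, a2, a3, b1, b2, b3⟩ := primrec_triple_projections (ℕ × ℕ × ℕ) (ℕ × ℕ × ℕ) (ℕ × ℕ × ℕ)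
  exact (primrecRel_fracEq.comp a1 b1).and
    ((primrecRel_fracEq.comp a2 b2).and (primrecRel_fracEq.comp a3 b3))

theorem primrec_pow : Primrec₂ pow := by
  have h : Primrec₂ fun (x : FracTri) (p : ℕ × FracTri) => mul p.2 x :=
    primrec_mul.comp (Primrec.snd.comp Primrec.snd) Primrec.fst
  exact (Primrec.nat_rec (f := fun _ : FracTri => ((1, 0, 0), (0, 0, 0), (1, 0, 0)))
    (Primrec.const _) h).of_eq fun x k => rfl

theorem primrec_prod (t : ℕ) :
    Primrec fun p : (FracTri × List FracTri) × List ℕ => prod p.1.1 p.1.2 p.2 t := by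
  have hx : Primrec fun p : (FracTri × List FracTri) × List ℕ => p.1.1 :=
    Primrec.fst.comp Primrec.fst
  have hL : ∀ i : ℕ, Primrec fun p : (FracTri × List FracTri) × List ℕ => p.1.2.getD i default :=
    fun i => (Primrec.list_getD default).comp (Primrec.snd.comp Primrec.fst) (Primrec.const i)
  induction t with
  | zero => exact hL 0
  | succ t ih =>
    exact primrec_mul.comp (primrec_mul.comp ih (primrec_pow.comp hx
      ((Primrec.list_getD 0).comp Primrec.snd (Primrec.const t)))) (hL (t + 1))

theorem primrec_den : Primrec den := by
  have h : ∀ {f : FracTri → ℕ × ℕ × ℕ}, Primrec f → Primrec fun x => (f x).2.2 + 1 :=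
    fun hf => Primrec.succ.comp (Primrec.snd.comp (Primrec.snd.comp hf))
  exact Primrec.nat_mul.comp (h Primrec.fst) (Primrec.nat_mul.comp
    (h (Primrec.fst.comp Primrec.snd)) (h (Primrec.snd.comp Primrec.snd)))

theorem primrec_height : Primrec height := by
  have h : ∀ {f : FracTri → ℕ × ℕ × ℕ}, Primrec f → Primrec fun x => (f x).1 + (f x).2.1 + 1 :=
    fun hf => Primrec.succ.comp (Primrec.nat_add.comp (Primrec.fst.comp hf)
      (Primrec.fst.comp (Primrec.snd.comp hf)))
  exact Primrec.nat_mul.comp (h Primrec.fst) (Primrec.nat_mul.comp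
    (h (Primrec.fst.comp Primrec.snd)) (h (Primrec.snd.comp Primrec.snd)))

theorem computable_ofMatrix : Computable ofMatrix := by
  have h : ∀ i j : Fin 2, Computable fun A : Fin 2 → Fin 2 → ℚ => ratFrac (A i j) := fun i j =>
    computable_ratFrac.comp (Computable.fin_app.comp
      (Computable.fin_app.comp Computable.id (Computable.const i)) (Computable.const j))
  exact (h 0 0).pair ((h 0 1).pair (h 1 1))

end FracTri

theorem primrec_list_prod_map {α : Type*} [Primcodable α] {f : α → ℕ} (hf : Primrec f) :
    Primrec fun l : List α => (l.map f).prod := by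
  refine (Primrec.list_foldr (h := fun _ (p : α × ℕ) => f p.1 * p.2) Primrec.id (Primrec.const 1)
    (Primrec.nat_mul.comp (hf.comp (Primrec.fst.comp Primrec.snd))
      (Primrec.snd.comp Primrec.snd)).to₂).of_eq fun l => ?_
  simp [List.prod_eq_foldr, List.foldr_map]

theorem primrec_pow_const (k : ℕ) : Primrec fun n : ℕ => n ^ k := by
  induction k with
  | zero => simpa using Primrec.const 1
  | succ k ih => simpa [pow_succ] using Primrec.nat_mul.comp ih Primrec.id

theorem primrec_collisionBound (t : ℕ) : Primrec (collisionBound t) :=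
  Primrec.nat_add.comp (Primrec.nat_mul.comp (Primrec.const _) (Primrec.succ.comp
    (Primrec.nat_mul.comp (Primrec.const 2) (Primrec.nat_mul.comp (Primrec.const _)
      (Primrec.nat_mul.comp (Primrec.const _) (primrec_pow_const (t + 2))))))) (Primrec.const 4)

/-- All lists of length `t` with entries at most `B`. -/
def boxLists (B : ℕ) : ℕ → List (List ℕ)
  | 0 => [[]]
  | t + 1 => (boxLists B t).flatMap fun l => (List.range (B + 1)).map fun b => b :: l

theorem mem_boxLists {B t : ℕ} {l : List ℕ} :
    l ∈ boxLists B t ↔ l.length = t ∧ ∀ b ∈ l, b ≤ B := by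
  induction t generalizing l with
  | zero =>
    simp only [boxLists, List.mem_singleton, List.length_eq_zero_iff]
    exact ⟨by rintro rfl; simp, fun h => h.1⟩
  | succ t ih =>
    simp only [boxLists, List.mem_flatMap, List.mem_map, List.mem_range, ih]
    constructor
    · rintro ⟨l, ⟨h1, h2⟩, b, hb, rfl⟩
      simpa [h1] using ⟨Nat.lt_succ_iff.1 hb, h2⟩
    · rintro ⟨h1, h2⟩
      cases l with
      | nil => simp at h1
      | cons b l =>
        simp only [List.length_cons, Nat.add_right_cancel_iff] at h1
        simp only [List.mem_cons, forall_eq_or_imp] at h2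
        exact ⟨l, ⟨h1, h2.2⟩, b, Nat.lt_succ_iff.2 h2.1, rfl⟩

theorem primrec_boxLists (t : ℕ) : Primrec fun B => boxLists B t := by
  induction t with
  | zero => exact Primrec.const _
  | succ t ih =>
    refine Primrec.list_flatMap ih (Primrec.list_map (g := fun p b => b :: p.2)
      (Primrec.list_range.comp (Primrec.succ.comp Primrec.fst)) ?_).to₂
    exact (Primrec.list_cons.comp Primrec.snd (Primrec.snd.comp Primrec.fst)).to₂

/-- A common denominator of all entries of the given matrices. -/
def commonDen (p : FracTri × List FracTri) : ℕ := p.1.den * (p.2.map FracTri.den).prod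

/-- A bound for the numerators of all entries over the common denominator. -/
def commonHeight (p : FracTri × List FracTri) : ℕ :=
  p.1.height * (p.2.map FracTri.height).prod * commonDen p

theorem primrec_commonHeight : Primrec commonHeight :=
  Primrec.nat_mul.comp (Primrec.nat_mul.comp (FracTri.primrec_height.comp Primrec.fst)
    ((primrec_list_prod_map FracTri.primrec_height).comp Primrec.snd))
    (Primrec.nat_mul.comp (FracTri.primrec_den.comp Primrec.fst)
      ((primrec_list_prod_map FracTri.primrec_den).comp Primrec.snd))

theorem FracTri.den_pos (x : FracTri) : 0 < x.den := by
  unfold FracTri.den; positivity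

theorem FracTri.height_pos (x : FracTri) : 0 < x.height := by
  unfold FracTri.height; positivity

theorem list_prod_map_pos {α : Type*} {f : α → ℕ} (hf : ∀ a, 0 < f a) (l : List α) :
    0 < (l.map f).prod :=
  Nat.pos_of_ne_zero (List.prod_ne_zero (by simpa using fun a _ => (hf a).ne'))

/-- Existence of a collision with exponents below the explicit bound. -/
def BoxCollision (t : ℕ) (p : FracTri × List FracTri) : Prop :=
  ∃ l ∈ boxLists (collisionBound t (commonHeight p)) t,
    ∃ l' ∈ boxLists (collisionBound t (commonHeight p)) t,
      l ≠ l' ∧ (FracTri.prod p.1 p.2 l t).Equiv (FracTri.prod p.1 p.2 l' t)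

theorem primrecPred_boxCollision (t : ℕ) : PrimrecPred (BoxCollision t) := by
  have hbox : Primrec fun p : FracTri × List FracTri =>
      boxLists (collisionBound t (commonHeight p)) t :=
    (primrec_boxLists t).comp ((primrec_collisionBound t).comp primrec_commonHeight)
  have h1 : PrimrecRel fun (l' : List ℕ) (q : List ℕ × FracTri × List FracTri) => q.1 ≠ l' ∧
      (FracTri.prod q.2.1 q.2.2 q.1 t).Equiv (FracTri.prod q.2.1 q.2.2 l' t) := by
    have hq1 : Primrec fun r : List ℕ × List ℕ × FracTri × List FracTri => r.2.1 :=
      Primrec.fst.comp Primrec.snd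
    have hq2 : Primrec fun r : List ℕ × List ℕ × FracTri × List FracTri => r.2.2 :=
      Primrec.snd.comp Primrec.snd
    exact (Primrec.eq.comp hq1 Primrec.fst).not.and (FracTri.primrecRel_equiv.comp
      ((FracTri.primrec_prod t).comp (hq2.pair hq1))
      ((FracTri.primrec_prod t).comp (hq2.pair Primrec.fst)))
  have h2 : PrimrecRel fun (l : List ℕ) (p : FracTri × List FracTri) =>
      ∃ l' ∈ boxLists (collisionBound t (commonHeight p)) t, l ≠ l' ∧
        (FracTri.prod p.1 p.2 l t).Equiv (FracTri.prod p.1 p.2 l' t) :=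
    h1.exists_mem_list.comp (hbox.comp Primrec.snd) Primrec.id
  exact h2.exists_mem_list.comp hbox Primrec.id

theorem boxCollision_iff {t : ℕ} (ht : 0 < t) {p : FracTri × List FracTri}
    (hlen : p.2.length = t + 1) (h0 : ∀ x ∈ p.2, x.val 0 0 ≠ 0) (h1 : ∀ x ∈ p.2, x.val 1 1 ≠ 0) :
    BoxCollision t p ↔ ∃ m n : ℕ → ℕ, (∃ i < t, m i ≠ n i) ∧
      boundedProd p.1.val (fun i => (p.2.getD i default).val) m t =
        boundedProd p.1.val (fun i => (p.2.getD i default).val) n t := by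
  constructor
  · rintro ⟨l, hl, l', hl', hne, heq⟩
    rw [mem_boxLists] at hl hl'
    rw [FracTri.equiv_iff, FracTri.val_prod, FracTri.val_prod] at heq
    refine ⟨_, _, ?_, heq⟩
    by_contra! hcon
    refine hne (List.ext_getElem (hl.1.trans hl'.1.symm) fun i hi hi' => ?_)
    have := hcon i (hl.1 ▸ hi)
    rwa [List.getD_eq_getElem _ _ hi, List.getD_eq_getElem _ _ hi'] at this
  · rintro ⟨m, n, hne, heq⟩
    have hmem : ∀ i, p.2.getD (min i t) default ∈ p.2 := fun i => by
      rw [List.getD_eq_getElem _ _ (by omega)]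
      exact List.getElem_mem _
    have hcongr : ∀ m : ℕ → ℕ, boundedProd p.1.val (fun i => (p.2.getD i default).val) m t =
        boundedProd p.1.val (fun i => (p.2.getD (min i t) default).val) m t := fun m =>
      boundedProd_congr _ (fun i hi => by rw [min_eq_left hi]) fun _ _ => rfl
    rw [hcongr, hcongr] at heq
    have hdvd : ∀ (f : FracTri → ℕ) (i : ℕ),
        f (p.2.getD (min i t) default) ∣ f p.1 * (p.2.map f).prod := fun f i =>
      (List.dvd_prod (List.mem_map_of_mem (hmem i))).mul_left _
    have hDpos : 0 < commonDen p :=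
      mul_pos p.1.den_pos (list_prod_map_pos FracTri.den_pos _)
    have hHpos := mul_pos p.1.height_pos (list_prod_map_pos FracTri.height_pos p.2)
    obtain ⟨m, n, hb, hne, heq⟩ := hasCollision_collisionBound (D := commonDen p)
      (H := commonHeight p) (M := p.1.val)
      (N := fun i => (p.2.getD (min i t) default).val) rfl (fun _ => rfl)
      (fun i => h0 _ (hmem i)) (fun i => h1 _ (hmem i)) hDpos (mul_pos hHpos hDpos)
      (FracTri.intBounded_val (dvd_mul_right _ _) (dvd_mul_right _ _) hHpos le_rfl)
      (fun i => FracTri.intBounded_val (hdvd _ i) (hdvd _ i) hHpos le_rfl) ht hne heq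
    have hofFn : ∀ m : ℕ → ℕ, ∀ i < t, m i = (List.ofFn fun i : Fin t => m i).getD i 0 :=
      fun m i hi => by simp [List.getD_eq_getElem?_getD, hi]
    refine ⟨List.ofFn fun i : Fin t => m i, ?_, List.ofFn fun i : Fin t => n i, ?_, ?_, ?_⟩
    · rw [mem_boxLists]
      simpa [List.mem_ofFn] using fun i : Fin t => (hb i i.2).1
    · rw [mem_boxLists]
      simpa [List.mem_ofFn] using fun i : Fin t => (hb i i.2).2
    · intro h
      obtain ⟨i, hi, hne⟩ := hne
      exact hne (congrFun (List.ofFn_injective h) ⟨i, hi⟩)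
    · rw [FracTri.equiv_iff, FracTri.val_prod, FracTri.val_prod, hcongr, hcongr,
        ← boundedProd_congr _ (fun _ _ => rfl) (hofFn m),
        ← boundedProd_congr _ (fun _ _ => rfl) (hofFn n), heq]

/-- for a fixed positive integer `t`, the injectivity problem for products
`N₁ M^{m₁} N₂ M^{m₂} ⋯ N_t M^{m_t} N_{t+1}` of upper-triangular `2 × 2` rational
matrices (with each `N_i` invertible) is decidable: there is a computable function that,
given the tuple `(M, N₁, …, N_{t+1})` (encoded as functions `Fin 2 → Fin 2 → ℚ`), decides
whether the map `ℕ^t → Matrix (Fin 2) (Fin 2) ℚ`,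
`(m₁,…,m_t) ↦ N₁ M^{m₁} N₂ ⋯ N_t M^{m_t} N_{t+1}`, is injective. -/
theorem bounded_freeness_decidable (t : ℕ) (ht : 0 < t) :
    ∃ f : ((Fin 2 → Fin 2 → ℚ) × (Fin (t + 1) → Fin 2 → Fin 2 → ℚ)) → Bool,
      Computable f ∧
      ∀ (M : Fin 2 → Fin 2 → ℚ) (N : Fin (t + 1) → Fin 2 → Fin 2 → ℚ),
        Matrix.of M 1 0 = 0 →
        (∀ i, Matrix.of (N i) 1 0 = 0) →
        (∀ i, (Matrix.of (N i)).det ≠ 0) →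
        (f (M, N) = true ↔
          Function.Injective (fun m : Fin t → ℕ =>
            (List.ofFn (fun i : Fin t =>
                Matrix.of (N i.castSucc) * (Matrix.of M) ^ m i)).prod *
              Matrix.of (N (Fin.last t)))) := by
  classical
  have hpre : Computable fun p : (Fin 2 → Fin 2 → ℚ) × (Fin (t + 1) → Fin 2 → Fin 2 → ℚ) =>
      (FracTri.ofMatrix p.1, List.ofFn fun i => FracTri.ofMatrix (p.2 i)) :=
    (FracTri.computable_ofMatrix.comp Computable.fst).pair (Computable.list_ofFn fun i =>
      FracTri.computable_ofMatrix.comp (Computable.fin_app.comp Computable.snd (Computable.const i)))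
  refine ⟨_, (primrecPred_boxCollision t).not.decide.to_comp.comp hpre, fun M N hM hN hdet => ?_⟩
  have hval : ∀ i, (FracTri.ofMatrix (N i)).val = Matrix.of (N i) := fun i =>
    FracTri.val_ofMatrix (hN i)
  have hdiag : ∀ i, N i 0 0 ≠ 0 ∧ N i 1 1 ≠ 0 := fun i => by
    have h := hdet i
    rw [Matrix.det_fin_two, hN, mul_zero, sub_zero] at h
    exact mul_ne_zero_iff.1 h
  have hprod : ∀ m : ℕ → ℕ, (List.ofFn fun i : Fin t =>
      Matrix.of (N i.castSucc) * (Matrix.of M) ^ m i).prod * Matrix.of (N (Fin.last t)) =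
      boundedProd (FracTri.ofMatrix M).val (fun i => ((List.ofFn fun i =>
        FracTri.ofMatrix (N i)).getD i default).val) m t := fun m => by
    rw [← prod_ofFn_mul_eq_boundedProd, FracTri.val_ofMatrix (A := M) hM]
    have hget : ∀ i : Fin (t + 1), ((List.ofFn fun i =>
        FracTri.ofMatrix (N i)).getD i default).val = Matrix.of (N i) := fun i => by
      rw [← hval, List.getD_eq_getElem _ _ (by rw [List.length_ofFn]; exact i.2),
        List.getElem_ofFn]
    have hlast := hget (Fin.last t)
    rw [Fin.val_last] at hlast
    rw [hlast]
    congr 3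
    funext i
    rw [← hget, Fin.val_castSucc]
  rw [decide_eq_true_iff, boxCollision_iff ht (by simp)
    (fun x hx => by
      obtain ⟨i, rfl⟩ := List.mem_ofFn.1 hx
      rw [hval]
      exact (hdiag i).1)
    (fun x hx => by
      obtain ⟨i, rfl⟩ := List.mem_ofFn.1 hx
      rw [hval]
      exact (hdiag i).2)]
  constructor
  · intro h m n hmn
    by_contra hne
    obtain ⟨i, hi⟩ := Function.ne_iff.1 hne
    refine h ⟨fun i => if h : i < t then m ⟨i, h⟩ else 0,
      fun i => if h : i < t then n ⟨i, h⟩ else 0, ⟨i, i.2, by simpa using hi⟩, ?_⟩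
    rw [← hprod, ← hprod]
    simpa using hmn
  · rintro hinj ⟨m, n, ⟨i, hi, hne⟩, heq⟩
    rw [← hprod, ← hprod] at heq
    exact hne (congrFun (hinj (a₁ := fun i : Fin t => m i) (a₂ := fun i : Fin t => n i) heq) ⟨i, hi⟩)
end

section
/- There exist positive integers k and t such that the following predicate is NOT computable: the predicate which takes a tuple (Z₁, X, Y, Z₂) of upper-triangular k×k matrices over ℤ and holds if and only if the map ℕ^t → Matrix (Fin k) (Fin k) ℤ sending (a₁,…,a_t) to Z₁ X^{a₁} Y X^{a₂} Y ⋯ Y X^{a_t} Z₂ is injective. -/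
/-- A square integer matrix (given as a function) is upper triangular if every entry
below the diagonal is 0. -/
def UpperTriFun {k : ℕ} (A : Fin k → Fin k → ℤ) : Prop :=
  ∀ p q : Fin k, (q : ℕ) < (p : ℕ) → A p q = 0

/-! ### Binomial coefficients and factorials in closed form -/

theorem Nat.choose_eq_div_mod (n k : ℕ) :
    n.choose k = (2 ^ n + 2) ^ n / (2 ^ n + 1) ^ k % (2 ^ n + 1) := by
  set u := 2 ^ n + 1 with hu
  have hlt : ∀ i, n.choose i < u := fun i => by
    have := Nat.choose_le_two_pow n i
    omega
  have hdig : ∀ m, ∑ i ∈ Finset.range m, n.choose i * u ^ i < u ^ m := by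
    intro m
    induction m with
    | zero => simp
    | succ m ih =>
      rw [Finset.sum_range_succ, pow_succ]
      have : n.choose m * u ^ m ≤ (u - 1) * u ^ m :=
        Nat.mul_le_mul_right _ (by have := hlt m; omega)
      have h1 : (u - 1) * u ^ m + u ^ m = u ^ m * u := by
        rw [mul_comm (u ^ m) u, ← Nat.succ_mul]
        congr 1
      omega
  have hsum : (u + 1) ^ n = ∑ i ∈ Finset.range (n + 1 + k), n.choose i * u ^ i := by
    rw [add_pow, Finset.sum_range_add _ (n + 1) k, Finset.sum_eq_zero (s := Finset.range k)]
    · simp [mul_comm]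
    · intro i _
      rw [Nat.choose_eq_zero_of_lt (by omega), zero_mul]
  have hu0 : 0 < u := Nat.succ_pos _
  rw [show 2 ^ n + 2 = u + 1 from rfl, hsum, show n + 1 + k = k + (n + 1) by ring,
    Finset.sum_range_add]
  have : ∑ x ∈ Finset.range (n + 1), n.choose (k + x) * u ^ (k + x) =
      u ^ k * (n.choose k + u * ∑ x ∈ Finset.range n, n.choose (k + (x + 1)) * u ^ x) := by
    rw [Finset.sum_range_succ', mul_add, Finset.mul_sum, Finset.mul_sum, add_comm]
    congr 1
    · simp [mul_comm]
    · exact Finset.sum_congr rfl fun x _ => by ring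
  rw [this, Nat.add_mul_div_left _ _ (pow_pos hu0 k), Nat.div_eq_of_lt (hdig k), zero_add,
    Nat.add_mul_mod_self_left, Nat.mod_eq_of_lt (hlt k)]

theorem Int.pow_mul_sub_le_mul_sub_pow {r n : ℤ} (hn : 0 ≤ n) (hr : n ≤ r) (m : ℕ) :
    r ^ m * (r - n * m) ≤ r * (r - n) ^ m := by
  induction m with
  | zero => simp
  | succ m ih =>
    have h1 := mul_le_mul_of_nonneg_right ih (sub_nonneg.2 hr)
    have h2 : 0 ≤ r ^ m * (n * n * m) := by
      have := pow_nonneg (hn.trans hr) m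
      positivity
    rw [pow_succ, pow_succ]
    push_cast
    linarith

theorem Nat.factorial_eq_div_choose (n : ℕ) :
    n.factorial = (n ^ 2 * (n ^ n + 1) + n + 1) ^ n / (n ^ 2 * (n ^ n + 1) + n + 1).choose n := by
  set r := n ^ 2 * (n ^ n + 1) + n + 1 with hr
  have hnr : n ≤ r := by omega
  have hC : 0 < r.choose n := Nat.choose_pos hnr
  have hD : r.descFactorial n = n.factorial * r.choose n :=
    Nat.descFactorial_eq_factorial_mul_choose r n
  have hle : r.descFactorial n ≤ r ^ n := Nat.descFactorial_le_pow r n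
  have hge : (r - n) ^ n ≤ r.descFactorial n :=
    (Nat.pow_le_pow_left (by omega) n).trans (Nat.pow_sub_le_descFactorial r n)
  have hfac : n.factorial ≤ n ^ n := Nat.factorial_le_pow n
  symm
  refine Nat.div_eq_of_lt_le (by rw [← hD]; exact hle) ?_
  refine lt_of_mul_lt_mul_left (a := n.factorial * r) ?_ (Nat.zero_le _)
  have key : n.factorial * r * r ^ n < (n.factorial + 1) * (r * (r - n) ^ n) := by
    have hb := Int.pow_mul_sub_le_mul_sub_pow (r := r) (n := n) (by positivity)
      (by exact_mod_cast hnr) n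
    zify [hnr]
    have hrn : (0 : ℤ) < (r : ℤ) ^ n := by positivity
    have h1 : (n : ℤ) ^ 2 * (n.factorial + 1) < r := by
      have : n ^ 2 * (n.factorial + 1) ≤ n ^ 2 * (n ^ n + 1) := by gcongr
      have : n ^ 2 * (n.factorial + 1) < r := by omega
      exact_mod_cast this
    have h2 := mul_le_mul_of_nonneg_left hb (show (0 : ℤ) ≤ n.factorial + 1 by positivity)
    have h3 := mul_lt_mul_of_pos_left h1 hrn
    linarith
  calc n.factorial * r * r ^ n < (n.factorial + 1) * (r * (r - n) ^ n) := key
    _ ≤ (n.factorial + 1) * (r * r.descFactorial n) := by gcongr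
    _ = n.factorial * r * ((n.factorial + 1) * r.choose n) := by rw [hD]; ring

/-! ### Elimination of bounded universal quantifiers -/

theorem Nat.exists_factors_choose {N y : ℕ} (hN : 3 ≤ N) (hy : y ≤ N) :
    ∃ m : ℕ → ℕ, (∀ k < y, (k + 1) * (m k + 1) = N.factorial ^ 2) ∧ (∀ k < y, 2 ≤ m k) ∧
      (∀ k < y, N.factorial.Coprime (m k)) ∧
      (N.factorial ^ 2 - 1).choose y = ∏ k ∈ Finset.range y, m k := by
  have h6 : 6 ≤ N.factorial := Nat.factorial_le hN
  have hk : ∀ k < y, (N.factorial / (k + 1)) * (k + 1) = N.factorial := fun k hk =>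
    Nat.div_mul_cancel (Nat.dvd_factorial (by omega) (by omega))
  have hpos : ∀ k < y, 0 < N.factorial / (k + 1) := fun k h => by
    rcases Nat.eq_zero_or_pos (N.factorial / (k + 1)) with h0 | h0
    · have := hk k h
      rw [h0] at this
      omega
    · exact h0
  let m : ℕ → ℕ := fun k => N.factorial / (k + 1) * N.factorial - 1
  have hm : ∀ k < y, m k + 1 = N.factorial / (k + 1) * N.factorial := fun k h => by
    have := Nat.mul_pos (hpos k h) (show 0 < N.factorial by omega)
    simp only [m]
    omega
  have hkm : ∀ k < y, (k + 1) * (m k + 1) = N.factorial ^ 2 := fun k h => by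
    rw [hm k h, ← mul_assoc, mul_comm (k + 1), hk k h, sq]
  refine ⟨m, hkm, fun k h => ?_, fun k h => ?_, ?_⟩
  · have := hm k h
    have := Nat.mul_le_mul (hpos k h) h6
    omega
  · refine Nat.Coprime.coprime_dvd_left (Dvd.intro_left _ (hm k h).symm) ?_
    simp
  · have h1 : (N.factorial ^ 2 - 1).descFactorial y =
        y.factorial * ∏ k ∈ Finset.range y, m k := by
      rw [Nat.descFactorial_eq_prod_range, ← Finset.prod_range_add_one_eq_factorial y,
        ← Finset.prod_mul_distrib]
      refine Finset.prod_congr rfl fun k h => ?_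
      have := hkm k (Finset.mem_range.1 h)
      rw [mul_add] at this
      omega
    rw [Nat.descFactorial_eq_factorial_mul_choose] at h1
    exact Nat.eq_of_mul_eq_mul_left y.factorial_pos h1

theorem Nat.dvd_descFactorial_of_modEq {m a x u : ℕ} (hx : x ≤ u) (h : a ≡ x [MOD m]) :
    m ∣ a.descFactorial (u + 1) := by
  rw [Nat.descFactorial_eq_prod_range]
  refine dvd_trans ?_ (Finset.dvd_prod_of_mem _ (Finset.mem_range.2 (Nat.lt_succ_of_le hx)))
  rcases le_total x a with hle | hle
  · exact (Nat.modEq_iff_dvd' hle).1 h.symm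
  · simp [Nat.sub_eq_zero_of_le hle]

theorem Nat.mod_le_of_prime_dvd_descFactorial {p a u : ℕ} (hp : p.Prime)
    (h : p ∣ a.descFactorial (u + 1)) : a % p ≤ u := by
  rw [Nat.descFactorial_eq_prod_range, hp.prime.dvd_finsetProd_iff] at h
  obtain ⟨j, hj, hd⟩ := h
  have hj := Finset.mem_range.1 hj
  rcases le_total j a with hle | hle
  · have : a % p = j % p := ((Nat.modEq_iff_dvd' hle).2 hd).symm
    have := Nat.mod_le j p
    omega
  · have := Nat.mod_le a p
    omega

theorem bounded_forall_iff_exists {β : Type*} [Fintype β] (P : ℕ → (β → ℕ) → ℤ) (y : ℕ)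
    (N : ℕ → ℕ) (hN3 : ∀ u, 3 ≤ N u) (hNy : ∀ u, y ≤ N u) (hNu : ∀ u, u < N u)
    (hcongr : ∀ (m k k' : ℕ) (x x' : β → ℕ), k ≡ k' [MOD m] → (∀ b, x b ≡ x' b [MOD m]) →
      P k x ≡ P k' x' [ZMOD m])
    (hbound : ∀ u, ∀ k < y, ∀ x : β → ℕ, (∀ b, x b ≤ u) → |P k x| ≤ N u) :
    (∀ k < y, ∃ x, P k x = 0) ↔
      ∃ (u : ℕ) (a : β → ℕ),
        (∀ b, ((N u).factorial ^ 2 - 1).choose y ∣ (a b).choose (u + 1)) ∧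
        (((N u).factorial ^ 2 - 1).choose y : ℤ) ∣ P ((N u).factorial ^ 2 - 1) a := by
  constructor
  · intro h
    choose! x hx using h
    let u := (Finset.range y).sup fun k => Finset.univ.sup (x k)
    have hu : ∀ k < y, ∀ b, x k b ≤ u := fun k hk b =>
      (Finset.le_sup (f := x k) (Finset.mem_univ b)).trans
        (Finset.le_sup (f := fun k => Finset.univ.sup (x k)) (Finset.mem_range.2 hk))
    obtain ⟨m, hm1, hm2, hm3, hm4⟩ := Nat.exists_factors_choose (hN3 u) (hNy u)
    set c := (N u).factorial ^ 2 - 1 with hc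
    have hck : ∀ k < y, c ≡ k [MOD m k] := fun k hk => by
      have h1 := hm1 k hk
      have : c = k + m k * (k + 1) := by
        rw [hc, ← h1, mul_add, mul_one, mul_comm]
        omega
      rw [this]
      simp [Nat.ModEq]
    have hcop : Set.Pairwise (Finset.range y : Set ℕ) (Function.onFun Nat.Coprime m) := by
      intro k hk l hl hkl
      have hk := Finset.mem_range.1 (Finset.mem_coe.1 hk)
      have hl := Finset.mem_range.1 (Finset.mem_coe.1 hl)
      refine Nat.coprime_of_dvd fun p hp hpk hpl => ?_
      have hkl' : k ≡ l [MOD p] :=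
        ((hck k hk).of_dvd hpk).symm.trans ((hck l hl).of_dvd hpl)
      have hpy : p ≤ N u := by
        have := hNy u
        have h1 : (p : ℤ) ∣ l - k := hkl'.dvd
        have h2 := Int.le_of_dvd (a := p) (b := |(l : ℤ) - k|) (by
          rw [abs_pos, sub_ne_zero]; exact_mod_cast hkl.symm) ((dvd_abs _ _).2 h1)
        have h3 : |(l : ℤ) - k| ≤ y := by rw [abs_le]; constructor <;> omega
        omega
      exact hp.one_lt.ne' (Nat.Coprime.eq_one_of_dvd
        ((hm3 k hk).symm.coprime_dvd_left hpk) (Nat.dvd_factorial hp.pos hpy))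
    have hne : ∀ k ∈ Finset.range y, m k ≠ 0 := fun k hk => by
      have := hm2 k (Finset.mem_range.1 hk)
      omega
    let a : β → ℕ := fun b =>
      Nat.chineseRemainderOfFinset (fun k => x k b) m (Finset.range y) hne hcop
    have ha : ∀ b, ∀ k < y, a b ≡ x k b [MOD m k] := fun b k hk =>
      (Nat.chineseRemainderOfFinset (fun k => x k b) m (Finset.range y) hne hcop).2 k
        (Finset.mem_range.2 hk)
    have hcop' : Set.Pairwise (Finset.range y : Set ℕ)
        (Function.onFun IsRelPrime m) := fun k hk l hl hkl =>
      Nat.coprime_iff_isRelPrime.1 (hcop hk hl hkl)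
    refine ⟨u, a, fun b => ?_, ?_⟩
    · rw [hm4]
      refine Finset.prod_dvd_of_isRelPrime hcop' fun k hk => ?_
      have hk := Finset.mem_range.1 hk
      have h1 := Nat.dvd_descFactorial_of_modEq (hu k hk b) (ha b k hk)
      rw [Nat.descFactorial_eq_factorial_mul_choose] at h1
      refine Nat.Coprime.dvd_of_dvd_mul_left ?_ h1
      exact (hm3 k hk).symm.coprime_dvd_right (Nat.factorial_dvd_factorial (hNu u))
    · rw [Int.natCast_dvd, hm4]
      refine Finset.prod_dvd_of_isRelPrime hcop' fun k hk => ?_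
      have hk := Finset.mem_range.1 hk
      rw [← Int.natCast_dvd, ← Int.modEq_zero_iff_dvd, ← hx k hk]
      exact hcongr _ _ _ _ _ (hck k hk) fun b => ha b k hk
  · rintro ⟨u, a, h1, h2⟩ k hk
    obtain ⟨m, hm1, hm2, hm3, hm4⟩ := Nat.exists_factors_choose (hN3 u) (hNy u)
    set c := (N u).factorial ^ 2 - 1 with hc
    have hm := hm2 k hk
    have hp : (m k).minFac.Prime := Nat.minFac_prime (by omega)
    set p := (m k).minFac
    have hpm : p ∣ m k := Nat.minFac_dvd _
    have hpM : p ∣ c.choose y := by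
      rw [hm4]
      exact hpm.trans (Finset.dvd_prod_of_mem _ (Finset.mem_range.2 hk))
    have hpN : N u < p := by
      by_contra hle
      exact hp.one_lt.ne' (Nat.Coprime.eq_one_of_dvd
        ((hm3 k hk).symm.coprime_dvd_left hpm) (Nat.dvd_factorial hp.pos (not_lt.1 hle)))
    have hck : c ≡ k [MOD p] := by
      have h1 := hm1 k hk
      have : c = k + m k * (k + 1) := by
        rw [hc, ← h1, mul_add, mul_one, mul_comm]
        omega
      rw [this]
      exact Nat.ModEq.of_dvd hpm (by simp [Nat.ModEq])
    have hxu : ∀ b, a b % p ≤ u := fun b => by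
      refine Nat.mod_le_of_prime_dvd_descFactorial hp ?_
      rw [Nat.descFactorial_eq_factorial_mul_choose]
      exact (hpM.trans (h1 b)).mul_left _
    refine ⟨fun b => a b % p, ?_⟩
    have h3 : (p : ℤ) ∣ P k fun b => a b % p := by
      rw [← Int.modEq_zero_iff_dvd]
      refine (hcongr p k c _ a hck.symm fun b => Nat.mod_modEq _ _).trans ?_
      rw [Int.modEq_zero_iff_dvd]
      exact (Int.natCast_dvd_natCast.2 hpM).trans h2
    refine Int.eq_zero_of_abs_lt_dvd h3 ?_
    have := hbound u k hk _ hxu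
    omega

namespace Poly

theorem modEq {γ : Type*} (p : Poly γ) {m : ℕ} {x x' : γ → ℕ} (h : ∀ i, x i ≡ x' i [MOD m]) :
    p x ≡ p x' [ZMOD m] := by
  induction p using Poly.induction with
  | H1 i => exact Int.natCast_modEq_iff.2 (h i)
  | H2 n => rfl
  | H3 f g hf hg => exact hf.sub hg
  | H4 f g hf hg => exact hf.mul hg

end Poly

namespace Dioph

open Sum Option

theorem exists_abs_le {γ δ : Type} (p : Poly γ) {D : γ → (δ → ℕ) → ℕ}
    (hD : ∀ i, DiophFn (D i)) :
    ∃ B : (δ → ℕ) → ℕ, DiophFn B ∧ ∀ w x, (∀ i, x i ≤ D i w) → |p x| ≤ B w := by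
  induction p using Poly.induction with
  | H1 i => exact ⟨D i, hD i, fun w x h => by simpa using h i⟩
  | H2 n => exact ⟨fun _ => n.natAbs, const_dioph _, fun w x _ => by simp⟩
  | H3 f g hf hg =>
    obtain ⟨B, hB, hf⟩ := hf
    obtain ⟨C, hC, hg⟩ := hg
    refine ⟨_, add_dioph hB hC, fun w x h => ?_⟩
    push_cast
    exact (abs_sub _ _).trans (add_le_add (hf w x h) (hg w x h))
  | H4 f g hf hg =>
    obtain ⟨B, hB, hf⟩ := hf
    obtain ⟨C, hC, hg⟩ := hg
    refine ⟨_, mul_dioph hB hC, fun w x h => ?_⟩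
    push_cast
    rw [Poly.mul_apply, abs_mul]
    exact mul_le_mul (hf w x h) (hg w x h) (abs_nonneg _) (Int.natCast_nonneg _)

/-- The dummy variables of a Diophantine set can be taken from a finite type. -/
theorem exists_fin_dummies {α : Type} {S : Set (α → ℕ)} (d : Dioph S) :
    ∃ (n : ℕ) (p : Poly (α ⊕ Fin n)), ∀ v, v ∈ S ↔ ∃ t, p (Sum.elim v t) = 0 := by
  classical
  obtain ⟨β, p, hp⟩ := d
  have key : ∀ p : Poly (α ⊕ β), ∃ s : Finset β, ∀ v t t', (∀ b ∈ s, t b = t' b) →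
      p (Sum.elim v t) = p (Sum.elim v t') := by
    intro p
    induction p using Poly.induction with
    | H1 i =>
      rcases i with i | b
      · exact ⟨∅, fun _ _ _ _ => rfl⟩
      · exact ⟨{b}, fun v t t' h => by simpa using h b (by simp)⟩
    | H2 n => exact ⟨∅, fun _ _ _ _ => rfl⟩
    | H3 f g hf hg =>
      obtain ⟨s, hs⟩ := hf
      obtain ⟨s', hs'⟩ := hg
      refine ⟨s ∪ s', fun v t t' h => ?_⟩
      rw [Poly.sub_apply, Poly.sub_apply, hs v t t' fun b hb => h b (by simp [hb]),
        hs' v t t' fun b hb => h b (by simp [hb])]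
    | H4 f g hf hg =>
      obtain ⟨s, hs⟩ := hf
      obtain ⟨s', hs'⟩ := hg
      refine ⟨s ∪ s', fun v t t' h => ?_⟩
      rw [Poly.mul_apply, Poly.mul_apply, hs v t t' fun b hb => h b (by simp [hb]),
        hs' v t t' fun b hb => h b (by simp [hb])]
  obtain ⟨s, hs⟩ := key p
  rcases isEmpty_or_nonempty β with hβ | ⟨⟨b₀⟩⟩
  · refine ⟨0, p.map (Sum.elim inl fun b => isEmptyElim b), fun v => (hp v).trans ?_⟩
    refine ⟨fun ⟨t, ht⟩ => ⟨Fin.elim0, ?_⟩, fun ⟨t, ht⟩ => ⟨isEmptyElim, ?_⟩⟩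
    · rw [Poly.map_apply, ← ht]
      congr 1
      ext i
      rcases i with i | b
      · rfl
      · exact isEmptyElim b
    · rw [Poly.map_apply] at ht
      rw [← ht]
      congr 1
      ext i
      rcases i with i | b
      · rfl
      · exact isEmptyElim b
  · let e := s.equivFin
    let φ : β → Fin (s.card + 1) := fun b =>
      if h : b ∈ s then (e ⟨b, h⟩).castSucc else Fin.last _
    let ψ : Fin (s.card + 1) → β := Fin.lastCases b₀ fun i => (e.symm i : β)
    refine ⟨s.card + 1, p.map (Sum.elim inl (inr ∘ φ)), fun v => (hp v).trans ?_⟩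
    have hmap : ∀ t, p.map (Sum.elim inl (inr ∘ φ)) (Sum.elim v t) = p (Sum.elim v (t ∘ φ)) := by
      intro t
      rw [Poly.map_apply]
      congr 1
      ext i
      rcases i with i | b <;> rfl
    refine ⟨fun ⟨t, ht⟩ => ⟨t ∘ ψ, ?_⟩, fun ⟨t, ht⟩ => ⟨t ∘ φ, by rw [← hmap, ht]⟩⟩
    rw [hmap, ← ht]
    refine hs _ _ _ fun b hb => ?_
    simp [φ, ψ, hb]

section
variable {α : Type}

theorem choose_dioph {f g : (α → ℕ) → ℕ} (hf : DiophFn f) (hg : DiophFn g) :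
    DiophFn fun v => (f v).choose (g v) := by
  simp only [Nat.choose_eq_div_mod]
  have h2 := pow_dioph (const_dioph 2) hf
  exact mod_dioph (div_dioph (pow_dioph (add_dioph h2 (const_dioph 2)) hf)
    (pow_dioph (add_dioph h2 (const_dioph 1)) hg)) (add_dioph h2 (const_dioph 1))

theorem factorial_dioph {f : (α → ℕ) → ℕ} (hf : DiophFn f) :
    DiophFn fun v => (f v).factorial := by
  simp only [Nat.factorial_eq_div_choose]
  have hr := add_dioph (add_dioph (mul_dioph (pow_dioph hf (const_dioph 2))
    (add_dioph (pow_dioph hf hf) (const_dioph 1))) hf) (const_dioph 1)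
  exact div_dioph (pow_dioph hr hf) (choose_dioph hr hf)

theorem comp_elim' {g : (Option α → ℕ) → ℕ} {c : (α → ℕ) → ℕ} (hg : DiophFn g) (hc : DiophFn c) :
    DiophFn fun v => g (Option.elim' (c v) v) := by
  have h1 : Dioph {z : Option (Option α) → ℕ |
      g (Option.elim' (z none) (z ∘ some ∘ some)) = z (some none)} := by
    refine eq_dioph ?_ (proj_dioph _)
    convert! reindex_diophFn (Option.elim' none (some ∘ some)) hg using 2 with z
    congr 1
    ext i
    cases i <;> rfl
  exact diophFn_comp1 h1 (reindex_diophFn some hc)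

theorem setOf_exists {S : (α → ℕ) → ℕ → Prop}
    (h : Dioph {w : Option α → ℕ | S (w ∘ some) (w none)}) : Dioph {v | ∃ x, S v x} :=
  ex1_dioph h

theorem setOf_forall_finite {β : Type} [Finite β] {S : β → Set (α → ℕ)} (h : ∀ b, Dioph (S b)) :
    Dioph {v | ∀ b, v ∈ S b} := by
  classical
  cases nonempty_fintype β
  refine ext (DiophList.forall (Finset.univ.toList.map S) ?_) fun v => ?_
  · simp [List.forall_iff_forall_mem, h]
  · simp [List.forall_iff_forall_mem]

/-- Diophantine predicates are closed under bounded universal quantification. -/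
theorem setOf_forall_lt {S : (α → ℕ) → ℕ → Prop} {f : (α → ℕ) → ℕ}
    (h : Dioph {w : Option α → ℕ | S (w ∘ some) (w none)}) (hf : DiophFn f) :
    Dioph {v | ∀ x < f v, S v x} := by
  obtain ⟨n, p, hp⟩ := exists_fin_dummies h
  obtain ⟨B, hB, hBp⟩ := exists_abs_le (δ := Option α) p
    (D := Sum.elim (fun o => o.elim (fun w => f (w ∘ some)) fun i w => w (some i))
      fun _ w => w none) (by
        rintro ((_ | i) | i)
        · exact reindex_diophFn some hf
        · exact proj_dioph _
        · exact proj_dioph _)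
  let N : (Option α → ℕ) → ℕ := fun w => B w + f (w ∘ some) + w none + 3
  have hN : DiophFn N := add_dioph (add_dioph (add_dioph hB (reindex_diophFn some hf))
    (proj_dioph none)) (const_dioph 3)
  let P : (α → ℕ) → ℕ → (Fin n → ℕ) → ℤ := fun v k x => p (Sum.elim (Option.elim' k v) x)
  have hS : ∀ v x, S v x ↔ ∃ t, P v x t = 0 := fun v x => hp (Option.elim' x v)
  have key : ∀ v, (∀ x < f v, S v x) ↔ ∃ (u : ℕ) (a : Fin n → ℕ),
      (∀ b, ((N (Option.elim' u v)).factorial ^ 2 - 1).choose (f v) ∣ (a b).choose (u + 1)) ∧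
      (((N (Option.elim' u v)).factorial ^ 2 - 1).choose (f v) : ℤ) ∣
        P v ((N (Option.elim' u v)).factorial ^ 2 - 1) a := by
    intro v
    simp only [hS]
    have hcomp : ∀ u, Option.elim' u v ∘ some = v := fun u => rfl
    refine bounded_forall_iff_exists (P v) (f v) (fun u => N (Option.elim' u v)) ?_ ?_ ?_ ?_ ?_
    · intro u
      simp only [N]
      omega
    · intro u
      simp only [N, hcomp]
      omega
    · intro u
      simp only [N, Option.elim'_none]
      omega
    · intro m k k' x x' hk hx
      refine p.modEq ?_
      rintro ((_ | i) | i)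
      · exact hk
      · exact Nat.ModEq.refl _
      · exact hx i
    · intro u k hk x hx
      have h1 := hBp (Option.elim' u v) (Sum.elim (Option.elim' k v) x) (by
        rintro ((_ | i) | i)
        · exact hk.le
        · exact le_rfl
        · exact hx i)
      have h2 : B (Option.elim' u v) ≤ N (Option.elim' u v) := by
        simp only [N]
        omega
      exact h1.trans (by exact_mod_cast h2)
  let M : (Option α → ℕ) → ℕ := fun w => ((N w).factorial ^ 2 - 1).choose (f (w ∘ some))
  have hc : DiophFn fun w => (N w).factorial ^ 2 - 1 :=
    sub_dioph (pow_dioph (factorial_dioph hN) (const_dioph 2)) (const_dioph 1)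
  have hM : DiophFn M := choose_dioph hc (reindex_diophFn some hf)
  have hdvd : ∀ b : Fin n, Dioph {w : Option α ⊕ Fin n → ℕ |
      M (w ∘ inl) ∣ (w (inr b)).choose (w (inl none) + 1)} := fun b =>
    dvd_dioph (reindex_diophFn inl hM)
      (choose_dioph (proj_dioph _) (add_dioph (proj_dioph _) (const_dioph 1)))
  have hval : DiophFn fun w : Option α ⊕ Fin n → ℕ =>
      (P (w ∘ inl ∘ some) ((N (w ∘ inl)).factorial ^ 2 - 1) (w ∘ inr)).natAbs := by
    exact comp_elim' (g := fun z =>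
      (p (Sum.elim (Option.elim' (z none) fun i => z (some (inl (some i))))
        fun b => z (some (inr b)))).natAbs)
      (abs_poly_dioph (p.map (Sum.elim (Option.elim' none (some ∘ inl ∘ some)) (some ∘ inr))) |>
        fun h => by
          convert h using 3 with z
          rw [Poly.map_apply]
          congr 2
          ext i
          rcases i with (_ | i) | i <;> rfl)
      (reindex_diophFn inl hc)
  refine Dioph.ext (setOf_exists (S := fun v u => ∃ a : Fin n → ℕ,
    Sum.elim (Option.elim' u v) a ∈ {w : Option α ⊕ Fin n → ℕ |
      (∀ b, w ∈ {w | M (w ∘ inl) ∣ (w (inr b)).choose (w (inl none) + 1)}) ∧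
      M (w ∘ inl) ∣
        (P (w ∘ inl ∘ some) ((N (w ∘ inl)).factorial ^ 2 - 1) (w ∘ inr)).natAbs}) ?_) ?_
  · refine Dioph.ext (ex_dioph (inter (setOf_forall_finite hdvd)
      (dvd_dioph (reindex_diophFn inl hM) hval))) ?_
    intro v
    have hv : Option.elim' (v none) (v ∘ some) = v := by
      ext i
      cases i <;> rfl
    change _ ↔ ∃ a, Sum.elim (Option.elim' (v none) (v ∘ some)) a ∈ _
    rw [hv]
    rfl
  · intro v
    refine Iff.trans ?_ (key v).symm
    refine exists_congr fun u => exists_congr fun a => and_congr Iff.rfl ?_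
    rw [Int.natCast_dvd]
    rfl

end
end Dioph

/-! ### Graphs of partial recursive functions are Diophantine -/

namespace Dioph

section
variable {α : Type}

theorem pair_dioph {f g : (α → ℕ) → ℕ} (hf : DiophFn f) (hg : DiophFn g) :
    DiophFn fun v => Nat.pair (f v) (g v) := by
  have hf' := reindex_diophFn some hf
  have hg' := reindex_diophFn some hg
  have hx : DiophFn fun w : Option α → ℕ => w none := proj_dioph none
  refine Dioph.ext (union
    (inter (lt_dioph hf' hg') (eq_dioph (add_dioph (mul_dioph hg' hg') hf') hx))
    (inter (le_dioph hg' hf') (eq_dioph (add_dioph (add_dioph (mul_dioph hf' hf') hf') hg') hx)))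
    fun w => ?_
  simp only [Set.mem_union, Set.mem_inter_iff, Set.mem_ofPred_eq, Nat.pair]
  split_ifs with h <;> simp [h, not_le.2, not_lt.1]

theorem unpair_fst_dioph {f : (α → ℕ) → ℕ} (hf : DiophFn f) :
    DiophFn fun v => (f v).unpair.1 := by
  refine Dioph.ext (setOf_exists (S := fun w x => Nat.pair (w none) x = f (w ∘ some))
    (eq_dioph (pair_dioph (proj_dioph (some none)) (proj_dioph none))
      (reindex_diophFn (some ∘ some) hf))) fun w => ?_
  simp only [Set.mem_ofPred_eq]
  constructor
  · rintro ⟨x, hx⟩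
    simp [← hx]
  · intro h
    exact ⟨(f (w ∘ some)).unpair.2, by rw [← h, Nat.pair_unpair]⟩

theorem unpair_snd_dioph {f : (α → ℕ) → ℕ} (hf : DiophFn f) :
    DiophFn fun v => (f v).unpair.2 := by
  refine Dioph.ext (setOf_exists (S := fun w x => Nat.pair x (w none) = f (w ∘ some))
    (eq_dioph (pair_dioph (proj_dioph none) (proj_dioph (some none)))
      (reindex_diophFn (some ∘ some) hf))) fun w => ?_
  simp only [Set.mem_ofPred_eq]
  constructor
  · rintro ⟨x, hx⟩
    simp [← hx]
  · intro h
    exact ⟨(f (w ∘ some)).unpair.1, by rw [← h, Nat.pair_unpair]⟩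

theorem beta_dioph {f g : (α → ℕ) → ℕ} (hf : DiophFn f) (hg : DiophFn g) :
    DiophFn fun v => Nat.beta (f v) (g v) :=
  mod_dioph (unpair_fst_dioph hf) (add_dioph (mul_dioph (add_dioph hg (const_dioph 1))
    (unpair_snd_dioph hf)) (const_dioph 1))

end

end Dioph

theorem Nat.exists_beta_eq (s : ℕ → ℕ) (n : ℕ) : ∃ c, ∀ i ≤ n, Nat.beta c i = s i := by
  refine ⟨Nat.unbeta (List.ofFn fun i : Fin (n + 1) => s i), fun i hi => ?_⟩
  have := Nat.beta_unbeta_coe (List.ofFn fun i : Fin (n + 1) => s i)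
    ⟨i, by simpa using Nat.lt_succ_of_le hi⟩
  simpa [-List.ofFn_succ] using this

theorem Part.mem_natRec_iff {a : Part ℕ} {g : ℕ → ℕ → Part ℕ} {n y : ℕ} :
    y ∈ (Nat.rec a (fun i IH => IH >>= g i) n : Part ℕ) ↔
      ∃ c, Nat.beta c 0 ∈ a ∧ (∀ i < n, Nat.beta c (i + 1) ∈ g i (Nat.beta c i)) ∧
        Nat.beta c n = y := by
  constructor
  · intro h
    have : ∃ s : ℕ → ℕ, s 0 ∈ a ∧ (∀ i < n, s (i + 1) ∈ g i (s i)) ∧ s n = y := by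
      induction n generalizing y with
      | zero => exact ⟨fun _ => y, h, by simp, rfl⟩
      | succ n ih =>
        obtain ⟨x, hx, hy⟩ := Part.mem_bind_iff.1 h
        obtain ⟨s, h0, hs, rfl⟩ := ih hx
        refine ⟨fun i => if i = n + 1 then y else s i, by simpa using h0, fun i hi => ?_, by simp⟩
        rcases Nat.lt_succ_iff_lt_or_eq.1 hi with h1 | rfl
        · have h2 : i ≠ n := h1.ne
          have h3 : i ≠ n + 1 := by omega
          simpa [h2, h3] using hs i h1
        · simpa using hy
    obtain ⟨s, h0, hs, rfl⟩ := this
    obtain ⟨c, hc⟩ := Nat.exists_beta_eq s n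
    refine ⟨c, by rwa [hc 0 (Nat.zero_le _)], fun i hi => ?_, hc n le_rfl⟩
    rw [hc _ hi, hc _ hi.le]
    exact hs i hi
  · rintro ⟨c, h0, hs, rfl⟩
    have : ∀ m ≤ n, Nat.beta c m ∈ (Nat.rec a (fun i IH => IH >>= g i) m : Part ℕ) := by
      intro m
      induction m with
      | zero => exact fun _ => h0
      | succ m ih => exact fun hm => Part.mem_bind (ih (by omega)) (hs m hm)
    exact this n le_rfl

open Dioph in
theorem Dioph.of_partrec {f : ℕ →. ℕ} (hf : Nat.Partrec f) :
    ∀ {α : Type} {g h : (α → ℕ) → ℕ}, DiophFn g → DiophFn h → Dioph {v | h v ∈ f (g v)} := by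
  induction hf with
  | zero =>
    intro α g h hg hh
    exact Dioph.ext (eq_dioph hh (const_dioph 0)) fun v => by
      simp [pure, PFun.pure]
  | succ =>
    intro α g h hg hh
    exact Dioph.ext (eq_dioph hh (add_dioph hg (const_dioph 1))) fun v => by simp
  | left =>
    intro α g h hg hh
    exact Dioph.ext (eq_dioph hh (unpair_fst_dioph hg)) fun v => by simp
  | right =>
    intro α g h hg hh
    exact Dioph.ext (eq_dioph hh (unpair_snd_dioph hg)) fun v => by simp
  | @pair f₁ f₂ _ _ ih₁ ih₂ =>
    intro α g h hg hh
    refine Dioph.ext (inter (ih₁ hg (unpair_fst_dioph hh)) (ih₂ hg (unpair_snd_dioph hh)))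
      fun v => ?_
    simp only [Set.mem_inter_iff, Set.mem_ofPred_eq, Seq.seq, Part.map_eq_map, Part.mem_bind_iff,
      Part.mem_map_iff]
    constructor
    · rintro ⟨h1, h2⟩
      exact ⟨_, ⟨_, h1, rfl⟩, _, h2, Nat.pair_unpair _⟩
    · rintro ⟨_, ⟨x, h1, rfl⟩, y, h2, h3⟩
      rw [← h3]
      simpa using ⟨h1, h2⟩
  | @comp f₁ f₂ _ _ ih₁ ih₂ =>
    intro α g h hg hh
    refine Dioph.ext (setOf_exists (S := fun v x => x ∈ f₂ (g v) ∧ h v ∈ f₁ x)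
      (inter (ih₂ (reindex_diophFn some hg) (proj_dioph none))
        (ih₁ (proj_dioph none) (reindex_diophFn some hh)))) fun v => ?_
    exact Part.mem_bind_iff.symm
  | @prec f₁ f₂ _ _ ih₁ ih₂ =>
    intro α g h hg hh
    have hi : DiophFn fun w : Option (Option α) → ℕ => w none := proj_dioph none
    have hc : DiophFn fun w : Option (Option α) → ℕ => w (some none) := proj_dioph _
    have hc' : DiophFn fun w : Option α → ℕ => w none := proj_dioph _
    have hg' := reindex_diophFn (some : α → Option α) hg
    have hg'' := reindex_diophFn (some ∘ some : α → Option (Option α)) hg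
    have hh' := reindex_diophFn (some : α → Option α) hh
    refine Dioph.ext (setOf_exists (S := fun v c =>
      Nat.beta c 0 ∈ f₁ (g v).unpair.1 ∧
      (∀ i < (g v).unpair.2, Nat.beta c (i + 1) ∈
        f₂ (Nat.pair (g v).unpair.1 (Nat.pair i (Nat.beta c i)))) ∧
      Nat.beta c (g v).unpair.2 = h v)
      (inter (ih₁ (unpair_fst_dioph hg') (beta_dioph hc' (const_dioph 0)))
        (inter (setOf_forall_lt (ih₂ (pair_dioph (unpair_fst_dioph hg'')
            (pair_dioph hi (beta_dioph hc hi)))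
            (beta_dioph hc (add_dioph hi (const_dioph 1)))) (unpair_snd_dioph hg'))
          (eq_dioph (beta_dioph hc' (unpair_snd_dioph hg')) hh')))) fun v => ?_
    exact (Part.mem_natRec_iff (a := f₁ (g v).unpair.1)
      (g := fun y i => f₂ (Nat.pair (g v).unpair.1 (Nat.pair y i)))).symm
  | @rfind f₁ _ ih =>
    intro α g h hg hh
    have hg' := reindex_diophFn (some : α → Option α) hg
    have hg'' := reindex_diophFn (some ∘ some : α → Option (Option α)) hg
    refine Dioph.ext (inter (ih (pair_dioph hg hh) (const_dioph 0))
      (setOf_forall_lt (S := fun v m => ∃ y, y + 1 ∈ f₁ (Nat.pair (g v) m))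
        (setOf_exists (S := fun w y => y + 1 ∈ f₁ (Nat.pair (g (w ∘ some)) (w none)))
          (ih (pair_dioph hg'' (proj_dioph (some none)))
            (add_dioph (proj_dioph none) (const_dioph 1)))) hh)) fun v => ?_
    refine Iff.trans ?_ Nat.mem_rfind.symm
    simp only [Part.map_eq_map, Part.mem_map_iff]
    refine and_congr ?_ (forall₂_congr fun m _ => ⟨fun ⟨y, hy⟩ => ⟨_, hy, by simp⟩, ?_⟩)
    · simp [Function.const]
    · rintro ⟨y, hy, h0⟩
      obtain ⟨z, rfl⟩ := Nat.exists_eq_succ_of_ne_zero (by simpa using h0)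
      exact ⟨z, hy⟩

/-- There is a Diophantine equation with one parameter whose solvability is undecidable. -/
theorem exists_poly_not_computablePred :
    ∃ (n : ℕ) (p : Poly (Unit ⊕ Fin n)),
      ¬ ComputablePred fun c : ℕ => ∃ t, p (Sum.elim (fun _ => c) t) = 0 := by
  have h1 : Nat.Partrec fun c => Nat.Partrec.Code.eval (Denumerable.ofNat _ c) 0 :=
    Partrec.nat_iff.1 (Nat.Partrec.Code.eval_part.comp (Computable.ofNat _) (Computable.const 0))
  have h2 : Dioph {v : Unit → ℕ | ∃ x, x ∈ Nat.Partrec.Code.eval (Denumerable.ofNat _ (v ())) 0} :=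
    Dioph.setOf_exists (Dioph.of_partrec h1 (Dioph.proj_dioph _) (Dioph.proj_dioph _))
  obtain ⟨n, p, hp⟩ := Dioph.exists_fin_dummies h2
  refine ⟨n, p, fun hc => ComputablePred.halting_problem 0 ?_⟩
  refine (ComputablePred.computable_iff.1 hc).elim fun f hf => ?_
  refine ComputablePred.computable_iff.2 ⟨fun c => f (Encodable.encode c),
    hf.1.comp Computable.encode, ?_⟩
  ext c
  have h3 := congrFun hf.2 (Encodable.encode c)
  rw [← h3, ← hp]
  simp [Part.dom_iff_mem]

/-! ### Realizing polynomials as entries of products of triangular matrices -/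

/-- The product `X ^ a₁ * Y * X ^ a₂ * Y * ⋯ * Y * X ^ aₜ` for the list `[a₁, …, aₜ]`. -/
def powInterspersedProd {M : Type*} [Monoid M] (X Y : M) (l : List ℕ) : M :=
  ((l.map (X ^ ·)).intersperse Y).prod

section powInterspersedProd

variable {M N : Type*} [Monoid M] [Monoid N]

theorem powInterspersedProd_singleton (X Y : M) (n : ℕ) :
    powInterspersedProd X Y [n] = X ^ n := by
  simp [powInterspersedProd]

theorem powInterspersedProd_cons_cons (X Y : M) (n n' : ℕ) (l : List ℕ) :
    powInterspersedProd X Y (n :: n' :: l) = X ^ n * (Y * powInterspersedProd X Y (n' :: l)) := by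
  simp [powInterspersedProd]

theorem map_powInterspersedProd (φ : M →* N) (X Y : M) (l : List ℕ) :
    φ (powInterspersedProd X Y l) = powInterspersedProd (φ X) (φ Y) l := by
  induction l with
  | nil => simp [powInterspersedProd]
  | cons n l ih =>
    cases l with
    | nil => simp [powInterspersedProd_singleton]
    | cons n' l => simp [powInterspersedProd_cons_cons, ih]

theorem powInterspersedProd_one_one (l : List ℕ) : powInterspersedProd (1 : M) 1 l = 1 := by
  simpa using (map_powInterspersedProd (1 : M →* M) 1 1 l).symm

theorem powInterspersedProd_prod (X Y : M × N) (l : List ℕ) :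
    powInterspersedProd X Y l =
      (powInterspersedProd X.1 Y.1 l, powInterspersedProd X.2 Y.2 l) :=
  Prod.ext (map_powInterspersedProd (MonoidHom.fst M N) X Y l)
    (map_powInterspersedProd (MonoidHom.snd M N) X Y l)

end powInterspersedProd

namespace Matrix

/-- `A.IsTriangularFor r` says that the off-diagonal nonzero entries of `A` lie at positions
`(i, j)` with `r i < r j`. -/
def IsTriangularFor {ι R : Type*} [Zero R] (r : ι → ℕ) (A : Matrix ι ι R) : Prop :=
  ∀ i j, A i j ≠ 0 → i = j ∨ r i < r j

namespace IsTriangularFor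

variable {ι κ R : Type*} [CommRing R]

theorem single [DecidableEq ι] (r : ι → ℕ) (i : ι) (x : R) :
    IsTriangularFor r (Matrix.single i i x) := by
  intro p q h
  by_cases hp : i = p <;> by_cases hq : i = q <;> simp_all [Matrix.single_apply]

theorem one [DecidableEq ι] (r : ι → ℕ) : IsTriangularFor r (1 : Matrix ι ι R) := by
  intro p q h
  by_contra hne
  exact h (Matrix.one_apply_ne fun e => hne (Or.inl e))

theorem add {r : ι → ℕ} {A B : Matrix ι ι R} (hA : IsTriangularFor r A)
    (hB : IsTriangularFor r B) : IsTriangularFor r (A + B) := by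
  intro p q h
  by_cases h1 : A p q = 0
  · exact hB p q fun h2 => h (by simp [h1, h2])
  · exact hA p q h1

theorem mul [Fintype ι] {r : ι → ℕ} {A B : Matrix ι ι R} (hA : IsTriangularFor r A)
    (hB : IsTriangularFor r B) : IsTriangularFor r (A * B) := by
  intro p q h
  obtain ⟨s, -, hs⟩ := Finset.exists_ne_zero_of_sum_ne_zero h
  rcases hA p s (left_ne_zero_of_mul hs) with rfl | h1 <;>
    rcases hB _ q (right_ne_zero_of_mul hs) with rfl | h2
  · exact Or.inl rfl
  · exact Or.inr h2
  · exact Or.inr h1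
  · exact Or.inr (h1.trans h2)

open scoped Kronecker in
theorem kronecker {r : ι → ℕ} {r' : κ → ℕ} {A : Matrix ι ι R} {B : Matrix κ κ R}
    (hA : IsTriangularFor r A) (hB : IsTriangularFor r' B) :
    IsTriangularFor (fun p : ι × κ => r p.1 + r' p.2) (A ⊗ₖ B) := by
  rintro ⟨p, p'⟩ ⟨q, q'⟩ h
  rcases hA p q (left_ne_zero_of_mul h) with rfl | h1 <;>
    rcases hB p' q' (right_ne_zero_of_mul h) with rfl | h2
  · exact Or.inl rfl
  all_goals right; dsimp only; omega

theorem fromBlocks_diagonal {r : ι → ℕ} {r' : κ → ℕ} (N : ℕ) {A : Matrix ι ι R}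
    {B : Matrix κ κ R} (hA : IsTriangularFor r A) (hB : IsTriangularFor r' B) :
    IsTriangularFor (Sum.elim r fun k => r' k + N) (fromBlocks A 0 0 B) := by
  rintro (p | p) (q | q) h
  · simpa using hA p q h
  · exact absurd rfl h
  · exact absurd rfl h
  · simpa using hB p q h

theorem blockDiagonal' {α : Type*} [DecidableEq α] {ι : α → Type*} {r : ∀ m, ι m → ℕ}
    {A : ∀ m, Matrix (ι m) (ι m) R} (hA : ∀ m, IsTriangularFor (r m) (A m)) :
    IsTriangularFor (fun p : Σ m, ι m => r p.1 p.2) (Matrix.blockDiagonal' A) := by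
  rintro ⟨m, p⟩ ⟨m', q⟩ h
  by_cases hm : m = m'
  · subst hm
    rw [Matrix.blockDiagonal'_apply_eq] at h
    rcases hA m p q h with rfl | h1
    · exact Or.inl rfl
    · exact Or.inr h1
  · exact absurd (Matrix.blockDiagonal'_apply_ne _ _ _ hm) h

end IsTriangularFor

/-- `F` occurs as the only nonzero entry of a product
`Z₁ * X ^ a₁ * Y * X ^ a₂ * ⋯ * Y * X ^ aₜ * Z₂` of triangular matrices, at a fixed position. -/
def IsTriangularEntry {R : Type*} [CommRing R] {t : ℕ} (F : (Fin t → ℕ) → R) : Prop :=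
  ∃ (ι : Type) (_ : Fintype ι) (_ : DecidableEq ι) (r : ι → ℕ) (Z₁ X Y Z₂ : Matrix ι ι R)
    (i j : ι), IsTriangularFor r Z₁ ∧ IsTriangularFor r X ∧ IsTriangularFor r Y ∧
      IsTriangularFor r Z₂ ∧
      ∀ a, Z₁ * powInterspersedProd X Y (List.ofFn a) * Z₂ = Matrix.single i j (F a)

namespace IsTriangularEntry

variable {R : Type*} [CommRing R] {t : ℕ}

theorem const (x : R) : IsTriangularEntry fun _ : Fin t → ℕ => x := by
  refine ⟨Unit, inferInstance, inferInstance, 0, Matrix.single () () x, 1, 1, 1, (), (),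
    .single _ _ _, .one _, .one _, .one _, fun a => ?_⟩
  rw [powInterspersedProd_one_one, mul_one, mul_one]

open scoped Kronecker in
theorem mul {F G : (Fin t → ℕ) → R} (hF : IsTriangularEntry F) (hG : IsTriangularEntry G) :
    IsTriangularEntry fun a => F a * G a := by
  obtain ⟨ι, _, _, r, Z₁, X, Y, Z₂, i, j, h1, h2, h3, h4, h⟩ := hF
  obtain ⟨κ, _, _, r', Z₁', X', Y', Z₂', i', j', h1', h2', h3', h4', h'⟩ := hG
  refine ⟨ι × κ, inferInstance, inferInstance, _, Z₁ ⊗ₖ Z₁', X ⊗ₖ X', Y ⊗ₖ Y', Z₂ ⊗ₖ Z₂',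
    (i, i'), (j, j'), h1.kronecker h1', h2.kronecker h2', h3.kronecker h3', h4.kronecker h4',
    fun a => ?_⟩
  let φ : Matrix ι ι R × Matrix κ κ R →* Matrix (ι × κ) (ι × κ) R :=
    { toFun := fun p => p.1 ⊗ₖ p.2
      map_one' := Matrix.one_kronecker_one
      map_mul' := fun p q => Matrix.mul_kronecker_mul _ _ _ _ }
  have hφ := map_powInterspersedProd φ (X, X') (Y, Y') (List.ofFn a)
  rw [powInterspersedProd_prod] at hφ
  change _ = powInterspersedProd (X ⊗ₖ X') (Y ⊗ₖ Y') (List.ofFn a) at hφ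
  rw [← hφ]
  change Z₁ ⊗ₖ Z₁' * (powInterspersedProd X Y (List.ofFn a) ⊗ₖ
    powInterspersedProd X' Y' (List.ofFn a)) * Z₂ ⊗ₖ Z₂' = _
  rw [← Matrix.mul_kronecker_mul, ← Matrix.mul_kronecker_mul, h, h',
    Matrix.single_kronecker_single]

theorem add {F G : (Fin t → ℕ) → R} (hF : IsTriangularEntry F) (hG : IsTriangularEntry G) :
    IsTriangularEntry fun a => F a + G a := by
  obtain ⟨ι, _, _, r, Z₁, X, Y, Z₂, i, j, h1, h2, h3, h4, h⟩ := hF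
  obtain ⟨κ, _, _, r', Z₁', X', Y', Z₂', i', j', h1', h2', h3', h4', h'⟩ := hG
  let N := r i + r j + 1
  let A : Matrix (ι ⊕ κ) (ι ⊕ κ) R :=
    fromBlocks (Matrix.single i i 1) (Matrix.single i i' 1) 0 0
  let B : Matrix (ι ⊕ κ) (ι ⊕ κ) R :=
    fromBlocks 0 (Matrix.single j j' 1) 0 (Matrix.single j' j' 1)
  have hA : IsTriangularFor (Sum.elim r fun k => r' k + N) A := by
    rintro (p | p) (q | q) hpq
    · simp only [A, fromBlocks_apply₁₁, Matrix.single_apply] at hpq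
      grind
    · simp only [A, fromBlocks_apply₁₂, Matrix.single_apply] at hpq
      grind
    · exact absurd rfl hpq
    · exact absurd rfl hpq
  have hB : IsTriangularFor (Sum.elim r fun k => r' k + N) B := by
    rintro (p | p) (q | q) hpq
    · exact absurd rfl hpq
    · simp only [B, fromBlocks_apply₁₂, Matrix.single_apply] at hpq
      grind
    · exact absurd rfl hpq
    · simp only [B, fromBlocks_apply₂₂, Matrix.single_apply] at hpq
      grind
  refine ⟨ι ⊕ κ, inferInstance, inferInstance, Sum.elim r fun k => r' k + N,
    A * fromBlocks Z₁ 0 0 Z₁', fromBlocks X 0 0 X', fromBlocks Y 0 0 Y',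
    fromBlocks Z₂ 0 0 Z₂' * B, Sum.inl i, Sum.inr j', hA.mul (h1.fromBlocks_diagonal N h1'),
    h2.fromBlocks_diagonal N h2', h3.fromBlocks_diagonal N h3',
    (h4.fromBlocks_diagonal N h4').mul hB, fun a => ?_⟩
  let φ : Matrix ι ι R × Matrix κ κ R →* Matrix (ι ⊕ κ) (ι ⊕ κ) R :=
    { toFun := fun p => fromBlocks p.1 0 0 p.2
      map_one' := fromBlocks_one
      map_mul' := fun p q => by simp [fromBlocks_multiply] }
  have hφ := map_powInterspersedProd φ (X, X') (Y, Y') (List.ofFn a)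
  rw [powInterspersedProd_prod] at hφ
  change fromBlocks _ 0 0 _ = powInterspersedProd (fromBlocks X 0 0 X') (fromBlocks Y 0 0 Y')
    (List.ofFn a) at hφ
  have hD : fromBlocks Z₁ 0 0 Z₁' * powInterspersedProd (fromBlocks X 0 0 X')
      (fromBlocks Y 0 0 Y') (List.ofFn a) * fromBlocks Z₂ 0 0 Z₂' =
      fromBlocks (Matrix.single i j (F a)) 0 0 (Matrix.single i' j' (G a)) := by
    rw [← hφ, fromBlocks_multiply, fromBlocks_multiply]
    simp [h, h']
  calc _ = A * (fromBlocks Z₁ 0 0 Z₁' * powInterspersedProd (fromBlocks X 0 0 X')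
      (fromBlocks Y 0 0 Y') (List.ofFn a) * fromBlocks Z₂ 0 0 Z₂') * B := by
        simp only [mul_assoc]
    _ = fromBlocks 0 (Matrix.single i j' (F a + G a)) 0 0 := by
        rw [hD]
        simp [A, B, fromBlocks_multiply, Matrix.single_add]
    _ = _ := by
        ext (p | p) (q | q) <;> simp [Matrix.single_apply]

theorem coord (m : Fin (t + 1)) :
    IsTriangularEntry fun a : Fin (t + 1) → ℕ => (a m : R) := by
  let E : Matrix (Fin (t + 1) × Fin 2) (Fin (t + 1) × Fin 2) R := Matrix.single (m, 0) (m, 1) 1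
  let Y : Matrix (Fin (t + 1) × Fin 2) (Fin (t + 1) × Fin 2) R :=
    fun q q' => if (q.1 : ℕ) + 1 = q'.1 ∧ q.2 = q'.2 then 1 else 0
  let v : ℕ → R → Fin (t + 1) × Fin 2 → R :=
    fun p x q => if (q.1 : ℕ) = p then (if q.2 = 0 then 1 else x) else 0
  have hX (n : ℕ) : (1 + E) ^ n = 1 + Matrix.single (m, 0) (m, 1) (n : R) := by
    induction n with
    | zero => simp
    | succ n ih =>
      rw [pow_succ, ih, Nat.cast_succ, Matrix.single_add]
      simp [E, add_mul, mul_add, add_assoc, add_comm]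
  have hvX (p : ℕ) (x : R) (n : ℕ) :
      v p x ᵥ* (1 + E) ^ n = v p (x + if p = m then (n : R) else 0) := by
    rw [hX, Matrix.vecMul_add, Matrix.vecMul_one]
    ext ⟨q, e⟩
    rw [Pi.add_apply, Matrix.vecMul, dotProduct, Finset.sum_eq_single (m, 0)]
    · simp only [v, Matrix.single_apply]
      fin_cases e <;> grind
    · rintro b - hb
      simp [hb.symm]
    · simp
  have hvY (p : ℕ) (x : R) : v p x ᵥ* Y = v (p + 1) x := by
    ext ⟨q, e⟩
    rw [Matrix.vecMul, dotProduct]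
    by_cases hq : (q : ℕ) = p + 1
    · rw [Finset.sum_eq_single (⟨p, by omega⟩, e)]
      · simp [v, Y, hq]
      · rintro ⟨b, e'⟩ - hb
        simp only [v, Y]
        grind
      · simp
    · rw [Finset.sum_eq_zero]
      · simp [v, hq]
      · rintro ⟨b, e'⟩ -
        simp only [v, Y]
        grind
  have hv (l : List ℕ) : ∀ (n p : ℕ) (x : R),
      v p x ᵥ* powInterspersedProd (1 + E) Y (n :: l) =
        v (p + l.length) (x + if p ≤ m then (((n :: l).getD (m - p) 0 : ℕ) : R) else 0) := by
    induction l with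
    | nil =>
      intro n p x
      rw [powInterspersedProd_singleton, hvX]
      congr 2
      rcases lt_trichotomy p m with h | h | h
      · rw [if_neg h.ne, if_pos h.le, show (m : ℕ) - p = m - (p + 1) + 1 by omega,
          List.getD_cons_succ, List.getD_nil, Nat.cast_zero]
      · simp [h]
      · rw [if_neg h.ne', if_neg (by omega)]
    | cons n' l ih =>
      intro n p x
      rw [powInterspersedProd_cons_cons, ← Matrix.vecMul_vecMul, ← Matrix.vecMul_vecMul, hvX, hvY,
        ih, List.length_cons, show p + 1 + l.length = p + (l.length + 1) by omega, add_assoc]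
      congr 2
      rcases lt_trichotomy p m with h | h | h
      · rw [if_neg h.ne, if_pos (by omega), if_pos h.le, zero_add,
          show (m : ℕ) - p = m - (p + 1) + 1 by omega, List.getD_cons_succ]
      · simp [h]
      · rw [if_neg h.ne', if_neg (by omega), if_neg (by omega), zero_add]
  refine ⟨Fin (t + 1) × Fin 2, inferInstance, inferInstance, fun p => p.1 + p.2,
    Matrix.single (0, 0) (0, 0) 1, 1 + E, Y, Matrix.single (Fin.last t, 1) (Fin.last t, 1) 1,
    (0, 0), (Fin.last t, 1), .single _ _ _, (IsTriangularFor.one _).add ?_, ?_, .single _ _ _,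
    fun a => ?_⟩
  · intro p q h
    simp only [E, Matrix.single_apply] at h
    right
    grind
  · intro p q h
    simp only [Y] at h
    right
    grind
  · rw [Matrix.single_mul_mul_single, one_mul, mul_one]
    congr 1
    have h0 : (Pi.single (0, 0) 1 : Fin (t + 1) × Fin 2 → R) = v 0 0 := by
      ext ⟨q, e⟩
      simp only [v, Pi.single_apply, Prod.mk.injEq]
      grind
    have h1 := congrFun (hv (List.ofFn fun i : Fin t => a i.succ) (a 0) 0 0) (Fin.last t, 1)
    rw [← List.ofFn_succ, ← h0, Matrix.single_one_vecMul] at h1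
    have h2 : (List.ofFn a).getD m 0 = a m := by
      rw [List.getD_eq_getElem _ _ (by simpa using m.is_le), List.getElem_ofFn]
    refine h1.trans ?_
    rw [Nat.sub_zero, h2]
    simp [v]

end IsTriangularEntry

end Matrix

theorem exists_equiv_fin_lt_of_lt {ι : Type*} [Fintype ι] (r : ι → ℕ) :
    ∃ e : ι ≃ Fin (Fintype.card ι), ∀ i j, r i < r j → e i < e j := by
  let _ : LinearOrder ι := LinearOrder.lift' (fun i => toLex (r i, Fintype.equivFin ι i))
    fun i j h => (Fintype.equivFin ι).injective (Prod.ext_iff.1 (toLex.injective h)).2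
  refine ⟨(monoEquivOfFin ι rfl).symm.toEquiv, fun i j h => ?_⟩
  refine (monoEquivOfFin ι rfl).symm.strictMono ?_
  exact Prod.Lex.toLex_lt_toLex.2 (Or.inl h)

/-- Finitely many triangular entries can be realized at once, by a single product of upper
triangular matrices indexed by `Fin k`. -/
theorem Matrix.IsTriangularEntry.exists_fin {R : Type*} [CommRing R] {t : ℕ} {α : Type}
    [Fintype α] [DecidableEq α] [Nonempty α] {F : α → (Fin t → ℕ) → R}
    (hF : ∀ m, IsTriangularEntry (F m)) :
    ∃ (k : ℕ) (Z₁ X Y Z₂ : Matrix (Fin k) (Fin k) R), 0 < k ∧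
      (∀ p q, q < p → Z₁ p q = 0 ∧ X p q = 0 ∧ Y p q = 0 ∧ Z₂ p q = 0) ∧
      ∀ {S : Type} [CommRing S] (φ : R →+* S) (a b : Fin t → ℕ),
        φ.mapMatrix (Z₁ * powInterspersedProd X Y (List.ofFn a) * Z₂) =
          φ.mapMatrix (Z₁ * powInterspersedProd X Y (List.ofFn b) * Z₂) ↔
        ∀ m, φ (F m a) = φ (F m b) := by
  choose ι _ _ r Z₁ X Y Z₂ i j h1 h2 h3 h4 h using hF
  obtain ⟨e, he⟩ := exists_equiv_fin_lt_of_lt fun p : Σ m, ι m => r p.1 p.2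
  let ψ : (∀ m, Matrix (ι m) (ι m) R) →+* Matrix (Fin _) (Fin _) R :=
    (reindexRingEquiv R e).toRingHom.comp (blockDiagonal'RingHom ι R)
  have hψ (A : ∀ m, Matrix (ι m) (ι m) R) : ψ A = (blockDiagonal' A).submatrix e.symm e.symm := rfl
  have htri {A : ∀ m, Matrix (ι m) (ι m) R} (hA : ∀ m, IsTriangularFor (r m) (A m))
      {p q : Fin _} (hpq : q < p) : ψ A p q = 0 := by
    by_contra hne
    rcases IsTriangularFor.blockDiagonal' hA _ _ hne with h' | h'
    · exact hpq.ne' (e.symm.injective h')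
    · exact hpq.not_gt (by simpa using he _ _ h')
  have hprod (a : Fin t → ℕ) : ψ Z₁ * powInterspersedProd (ψ X) (ψ Y) (List.ofFn a) * ψ Z₂ =
      ψ fun m => Matrix.single (i m) (j m) (F m a) := by
    have hw := map_powInterspersedProd ψ.toMonoidHom X Y (List.ofFn a)
    change ψ _ = powInterspersedProd (ψ X) (ψ Y) (List.ofFn a) at hw
    rw [← hw, ← map_mul, ← map_mul]
    congr 1
    ext1 m
    rw [← h]
    simp only [Pi.mul_apply]
    congr 2
    exact map_powInterspersedProd (Pi.evalMonoidHom _ m) X Y (List.ofFn a)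
  refine ⟨_, ψ Z₁, ψ X, ψ Y, ψ Z₂, ?_, fun p q hpq => ⟨htri h1 hpq, htri h2 hpq, htri h3 hpq,
    htri h4 hpq⟩, fun φ a b => ?_⟩
  · have m := Classical.arbitrary α
    exact Fintype.card_pos_iff.2 ⟨⟨m, i m⟩⟩
  · rw [hprod, hprod]
    constructor
    · intro hab m
      have := congrFun (congrFun hab (e ⟨m, i m⟩)) (e ⟨m, j m⟩)
      simpa [hψ] using this
    · intro hab
      have hmap (a : Fin t → ℕ) : φ.mapMatrix (ψ fun m => Matrix.single (i m) (j m) (F m a)) =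
          (blockDiagonal' fun m => Matrix.single (i m) (j m) (φ (F m a))).submatrix
            e.symm e.symm := by
        rw [hψ, RingHom.mapMatrix_apply, ← Matrix.submatrix_map, blockDiagonal'_map _ _ φ.map_zero]
        simp
      simp_rw [hmap, hab]

open Polynomial in
theorem Poly.exists_isTriangularEntry {n : ℕ} (p : Poly (Unit ⊕ Fin n)) :
    ∃ F : (Fin (n + 1) → ℕ) → ℤ[X], Matrix.IsTriangularEntry F ∧
      ∀ (c : ℕ) (a : Fin (n + 1) → ℕ),
        (F a).eval (c : ℤ) = p (Sum.elim (fun _ => c) (a ∘ Fin.castSucc)) := by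
  induction p using Poly.induction with
  | H1 i =>
    cases i with
    | inl i => exact ⟨_, .const X, fun c a => by simp⟩
    | inr i => exact ⟨_, .coord i.castSucc, fun c a => by simp⟩
  | H2 x => exact ⟨_, .const (C x), fun c a => by simp⟩
  | H3 f g hf hg =>
    obtain ⟨F, hF, hF'⟩ := hf
    obtain ⟨G, hG, hG'⟩ := hg
    exact ⟨_, hF.add ((Matrix.IsTriangularEntry.const (-1)).mul hG), fun c a => by
      simp [hF', hG', sub_eq_add_neg]⟩
  | H4 f g hf hg =>
    obtain ⟨F, hF, hF'⟩ := hf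
    obtain ⟨G, hG, hG'⟩ := hg
    exact ⟨_, hF.mul hG, fun c a => by simp [hF', hG']⟩

/-- There is a one-parameter family of tuples of upper triangular matrices, with entries polynomial
in the parameter `c`, for which injectivity of the associated map fails exactly when the Diophantine
equation `p (c, ·) = 0` is solvable. -/
theorem Poly.exists_matrices_injective_iff {n : ℕ} (p : Poly (Unit ⊕ Fin n)) :
    ∃ (k : ℕ) (Z₁ X Y Z₂ : Matrix (Fin k) (Fin k) (Polynomial ℤ)), 0 < k ∧
      (∀ p q, q < p → Z₁ p q = 0 ∧ X p q = 0 ∧ Y p q = 0 ∧ Z₂ p q = 0) ∧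
      ∀ c : ℕ, (Function.Injective fun a : Fin (n + 1) → ℕ =>
        Z₁.map (Polynomial.eval (c : ℤ)) * powInterspersedProd (X.map (Polynomial.eval (c : ℤ)))
          (Y.map (Polynomial.eval (c : ℤ))) (List.ofFn a) * Z₂.map (Polynomial.eval (c : ℤ))) ↔
        ¬ ∃ t, p (Sum.elim (fun _ => c) t) = 0 := by
  obtain ⟨P, hP, hP'⟩ := p.exists_isTriangularEntry
  let F : Option (Fin n) → (Fin (n + 1) → ℕ) → Polynomial ℤ := fun m =>
    Option.elim m (fun a => a (Fin.last n) * P a) fun m a => a m.castSucc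
  have hF (m) : Matrix.IsTriangularEntry (F m) := by
    cases m with
    | none => exact (Matrix.IsTriangularEntry.coord _).mul hP
    | some m => exact .coord _
  obtain ⟨k, Z₁, X, Y, Z₂, hk, htri, h⟩ := Matrix.IsTriangularEntry.exists_fin hF
  refine ⟨k, Z₁, X, Y, Z₂, hk, htri, fun c => ?_⟩
  have hprod (a : Fin (n + 1) → ℕ) :
      Z₁.map (Polynomial.eval (c : ℤ)) * powInterspersedProd (X.map (Polynomial.eval (c : ℤ)))
          (Y.map (Polynomial.eval (c : ℤ))) (List.ofFn a) * Z₂.map (Polynomial.eval (c : ℤ)) =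
        (Polynomial.evalRingHom (c : ℤ)).mapMatrix
          (Z₁ * powInterspersedProd X Y (List.ofFn a) * Z₂) := by
    rw [map_mul, map_mul]
    congr 2
    exact (map_powInterspersedProd
      (Polynomial.evalRingHom (c : ℤ)).mapMatrix.toMonoidHom X Y (List.ofFn a)).symm
  simp_rw [hprod]
  have h' (a b : Fin (n + 1) → ℕ) := h (Polynomial.evalRingHom (c : ℤ)) a b
  simp only [Option.forall, F, Option.elim_none, Option.elim_some, Polynomial.coe_evalRingHom,
    Polynomial.eval_mul, Polynomial.eval_natCast, hP', Nat.cast_inj] at h'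
  constructor
  · rintro hinj ⟨t, ht⟩
    have := hinj ((h' (Fin.snoc t 0) (Fin.snoc t 1)).2 (by
      simp [Function.comp_def, ht]))
    simpa using congrFun this (Fin.last n)
  · intro hp a b hab
    obtain ⟨h1, h2⟩ := (h' a b).1 hab
    have h3 : a ∘ Fin.castSucc = b ∘ Fin.castSucc := funext h2
    rw [h3] at h1
    have h4 := mul_right_cancel₀ (fun h0 => hp ⟨_, h0⟩) h1
    ext m
    cases m using Fin.lastCases with
    | last => exact_mod_cast h4
    | cast m => exact h2 m

/-! ### Computability of the family of matrices -/

theorem Primrec.natCast_sub_natCast {g h : ℕ → ℕ} (hg : Primrec g) (hh : Primrec h) :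
    Primrec fun c => (g c : ℤ) - h c := by
  refine Primrec.encode_iff.1 (Primrec.of_eq (f := fun c =>
    if h c ≤ g c then 2 * (g c - h c) else 2 * (h c - g c - 1) + 1) ?_ fun c => ?_)
  · exact Primrec.ite (Primrec.nat_le.comp hh hg)
      (Primrec.nat_mul.comp (Primrec.const 2) (Primrec.nat_sub.comp hg hh))
      (Primrec.succ.comp (Primrec.nat_mul.comp (Primrec.const 2)
        (Primrec.nat_sub.comp (Primrec.nat_sub.comp hh hg) (Primrec.const 1))))
  · split_ifs with hle
    · obtain ⟨d, hd⟩ := Nat.exists_eq_add_of_le hle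
      have : (g c : ℤ) - h c = Int.ofNat d := by simp [hd]
      rw [this, hd, Nat.add_sub_cancel_left]
      rfl
    · obtain ⟨d, hd⟩ := Nat.exists_eq_add_of_lt (not_le.1 hle)
      have : (g c : ℤ) - h c = Int.negSucc d := by rw [hd, Int.negSucc_eq]; push_cast; ring
      rw [this, hd, show g c + d + 1 - g c - 1 = d by omega]
      rfl

theorem Polynomial.primrec_eval_natCast (q : Polynomial ℤ) :
    Primrec fun c : ℕ => q.eval (c : ℤ) := by
  suffices ∃ g h : ℕ → ℕ, Primrec g ∧ Primrec h ∧ ∀ c : ℕ, q.eval (c : ℤ) = g c - h c by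
    obtain ⟨g, h, hg, hh, hq⟩ := this
    simpa only [hq] using hg.natCast_sub_natCast hh
  induction q using Polynomial.induction_on' with
  | add q q' hq hq' =>
    obtain ⟨g, h, hg, hh, hq⟩ := hq
    obtain ⟨g', h', hg', hh', hq'⟩ := hq'
    refine ⟨_, _, Primrec.nat_add.comp hg hg', Primrec.nat_add.comp hh hh', fun c => ?_⟩
    rw [Polynomial.eval_add, hq, hq']
    push_cast
    ring
  | monomial m x =>
    have hpow : Primrec fun c : ℕ => c ^ m := by
      induction m with
      | zero => simpa using Primrec.const 1
      | succ m ih => simpa only [pow_succ, id] using Primrec.nat_mul.comp ih .id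
    refine ⟨_, _, Primrec.nat_mul.comp (Primrec.const x.toNat) hpow,
      Primrec.nat_mul.comp (Primrec.const (-x).toNat) hpow, fun c => ?_⟩
    rw [Polynomial.eval_monomial]
    push_cast
    rw [← sub_mul]
    congr 1
    omega

theorem Matrix.primrec_map_eval {k l : ℕ} (A : Matrix (Fin k) (Fin l) (Polynomial ℤ)) :
    Primrec fun c : ℕ => (fun i j => (A i j).eval (c : ℤ) : Fin k → Fin l → ℤ) :=
  Primrec.fin_curry.2 <| Primrec₂.swap <| Primrec.fin_curry₁.2 fun i =>
    Primrec.fin_curry.2 <| Primrec₂.swap <| Primrec.fin_curry₁.2 fun j =>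
      (A i j).primrec_eval_natCast

/-- there exist positive integers `k` and `t` such that no computable
function decides, given a tuple `(Z₁, X, Y, Z₂)` of upper-triangular `k × k` integer
matrices, whether the map `ℕ^t → Matrix (Fin k) (Fin k) ℤ`,
`(a₁,…,a_t) ↦ Z₁ X^{a₁} Y X^{a₂} Y ⋯ Y X^{a_t} Z₂`, is injective. -/
theorem bounded_freeness_undecidable :
    ∃ k t : ℕ, 0 < k ∧ 0 < t ∧
      ¬ ∃ f : ((Fin k → Fin k → ℤ) × (Fin k → Fin k → ℤ) × (Fin k → Fin k → ℤ) ×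
              (Fin k → Fin k → ℤ)) → Bool,
        Computable f ∧
        ∀ Z₁ X Y Z₂ : Fin k → Fin k → ℤ,
          UpperTriFun Z₁ → UpperTriFun X → UpperTriFun Y → UpperTriFun Z₂ →
          (f (Z₁, X, Y, Z₂) = true ↔
            Function.Injective (fun a : Fin t → ℕ =>
              Matrix.of Z₁ *
                (List.intersperse (Matrix.of Y)
                  (List.ofFn fun i : Fin t => (Matrix.of X) ^ a i)).prod *
                Matrix.of Z₂)) := by
  obtain ⟨n, p, hp⟩ := exists_poly_not_computablePred
  obtain ⟨k, Z₁, X, Y, Z₂, hk, htri, h⟩ := p.exists_matrices_injective_iff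
  refine ⟨k, n + 1, hk, n.succ_pos, fun ⟨f, hf, hfi⟩ => hp ?_⟩
  have hcomp : Computable fun c : ℕ => f
      (fun i j => (Z₁ i j).eval (c : ℤ), fun i j => (X i j).eval (c : ℤ),
        fun i j => (Y i j).eval (c : ℤ), fun i j => (Z₂ i j).eval (c : ℤ)) :=
    hf.comp <| Primrec.to_comp <| Z₁.primrec_map_eval.pair <| X.primrec_map_eval.pair <|
      Y.primrec_map_eval.pair Z₂.primrec_map_eval
  have hnot : ComputablePred fun c : ℕ => ¬ ∃ t, p (Sum.elim (fun _ => c) t) = 0 := by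
    refine ComputablePred.computable_iff.2 ⟨_, hcomp, ?_⟩
    ext c
    rw [hfi, ← h c]
    · simp only [powInterspersedProd, List.map_ofFn]
      rfl
    · exact fun p q hpq => by simp [(htri p q hpq).1]
    · exact fun p q hpq => by simp [(htri p q hpq).2.1]
    · exact fun p q hpq => by simp [(htri p q hpq).2.2.1]
    · exact fun p q hpq => by simp [(htri p q hpq).2.2.2]
  simpa using hnot.not
end
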